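/- Let n>=2 and let K=K(c) be a symmetric A_{2n-1}-crystal. Then the symmetric extract B=(S, E_{1bar} disjoint-union ... disjoint-union E_{nbar}) from K is a B_n-crystal, and its parameter equals (c_1,...,c_n). -/

import Mathlib

open Classical

noncomputable section

/-- Iterate a partial operator `k` times. -/
def optIter {V : Type} (f : V → Option V) : ℕ → V → Option V
  | 0, v => some v
  | k + 1, v => (f v).bind (optIter f k)

/-- A vertex type together with, for every natural number (color) `i`,
a partial operator whose graph is the set of `i`-edges. -/
structure PreGraph where
  V : Type
  F : ℕ → V → Option V

namespace PreGraph

/-- Partial inverse operator of color `i`. -/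
def Finv (K : PreGraph) (i : ℕ) (v : K.V) : Option K.V :=
  if h : ∃ u, K.F i u = some v then some h.choose else none

/-- Number of edges of the maximal `i`-colored path beginning at `v`. -/
def h (K : PreGraph) (i : ℕ) (v : K.V) : ℕ :=
  sSup {k | (optIter (K.F i) k v).isSome = true}

/-- Number of edges of the maximal `i`-colored path ending at `v`. -/
def t (K : PreGraph) (i : ℕ) (v : K.V) : ℕ :=
  sSup {k | ∃ u, optIter (K.F i) k u = some v}

/-- One (undirected) step along an edge of any color. -/
def Step (K : PreGraph) (u v : K.V) : Prop :=
  ∃ i, K.F i u = some v ∨ K.F i v = some u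

/-- Weak connectivity. -/
def Connected (K : PreGraph) : Prop :=
  ∀ u v : K.V, Relation.ReflTransGen K.Step u v

/-- All edges have colors in `C`. -/
def ColorsIn (K : PreGraph) (C : Set ℕ) : Prop :=
  ∀ i ∉ C, ∀ v, K.F i v = none

end PreGraph

/-- `s` has no incoming edges. -/
def IsSource (K : PreGraph) (s : K.V) : Prop := ∀ i u, K.F i u ≠ some s

/-- `tv` has no outgoing edges. -/
def IsSink (K : PreGraph) (tv : K.V) : Prop := ∀ i, K.F i tv = none

/-- `K` is a (finite) colored graph with colors in `C` satisfying axiom (A1):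
every connected monochromatic subgraph is a finite directed path. -/
def IsColored (K : PreGraph) (C : Set ℕ) : Prop :=
  Finite K.V ∧ K.ColorsIn C ∧
  (∀ (i : ℕ) (u u' v : K.V), K.F i u = some v → K.F i u' = some v → u = u') ∧
  (∀ (i : ℕ) (v : K.V) (k : ℕ), 0 < k → optIter (K.F i) k v ≠ some v)

/-- `|i - j| = 1`. -/
def Neighb (i j : ℕ) : Prop := i + 1 = j ∨ j + 1 = i

/-- `|i - j| ≥ 2`. -/
def Far (i j : ℕ) : Prop := i + 2 ≤ j ∨ j + 2 ≤ i

instance (i j : ℕ) : Decidable (Neighb i j) := by unfold Neighb; infer_instance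
instance (i j : ℕ) : Decidable (Far i j) := by unfold Far; infer_instance

/-- Axiom (A2) for the ordered pair of distinct colors `(i, j)`. -/
def A2at (K : PreGraph) (i j : ℕ) : Prop :=
  (∀ u v, K.F i u = some v →
    K.t j v ≤ K.t j u ∧ K.h j u ≤ K.h j v ∧
    ((K.h j u : ℤ) - (K.t j u : ℤ)) - ((K.h j v : ℤ) - (K.t j v : ℤ)) =
      (if Neighb i j then (-1 : ℤ) else 0)) ∧
  (∀ u v w, K.F i u = some v → K.F i v = some w →
    2 * K.h j v ≤ K.h j u + K.h j w)

/-- Axiom (A3) for neighboring colors `i, j`. -/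
def A3at (K : PreGraph) (i j : ℕ) : Prop :=
  (∀ u v v', K.F i u = some v → K.F j u = some v' →
    K.h j v = K.h j u →
    ((K.h i v' : ℤ) - (K.h i u : ℤ) = 1 ∧ ∃ w, K.F j v = some w ∧ K.F i v' = some w)) ∧
  (∀ u u' v, K.F i u = some v → K.F j u' = some v →
    (K.h j v : ℤ) - (K.h j u : ℤ) = 1 →
    (K.h i v = K.h i u' ∧ ∃ w, K.F j w = some u ∧ K.F i w = some u'))

/-- Axiom (A4) (Verma relations) for neighboring colors `i, j`. -/
def A4at (K : PreGraph) (i j : ℕ) : Prop :=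
  (∀ u v v', K.F i u = some v → K.F j u = some v' →
    (K.h j v : ℤ) - (K.h j u : ℤ) = 1 → (K.h i v' : ℤ) - (K.h i u : ℤ) = 1 →
    ∃ w, (((K.F i u).bind (K.F j)).bind (K.F j)).bind (K.F i) = some w ∧
         (((K.F j u).bind (K.F i)).bind (K.F i)).bind (K.F j) = some w) ∧
  (∀ u u' v, K.F i u = some v → K.F j u' = some v →
    K.h j v = K.h j u → K.h i v = K.h i u' →
    ∃ w, (((K.Finv i v).bind (K.Finv j)).bind (K.Finv j)).bind (K.Finv i) = some w ∧
         (((K.Finv j v).bind (K.Finv i)).bind (K.Finv i)).bind (K.Finv j) = some w)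

/-- Axiom (A5) for colors `i, j` at distance at least 2. -/
def A5at (K : PreGraph) (i j : ℕ) : Prop :=
  ∀ Fi ∈ ({K.F i, K.Finv i} : Set (K.V → Option K.V)),
  ∀ Fj ∈ ({K.F j, K.Finv j} : Set (K.V → Option K.V)),
  ∀ v, (Fi v).isSome → (Fj v).isSome →
    ∃ w, (Fi v).bind Fj = some w ∧ (Fj v).bind Fi = some w

/-- `K` is a regular crystal of type A on the color set `C`
(an `A_{|C|}`-crystal when `C` is an integer interval). -/
def IsCrystalOn (K : PreGraph) (C : Set ℕ) : Prop :=
  IsColored K C ∧ K.Connected ∧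
  (∀ i ∈ C, ∀ j ∈ C, i ≠ j → A2at K i j) ∧
  (∀ i ∈ C, ∀ j ∈ C, Neighb i j → A3at K i j ∧ A4at K i j) ∧
  (∀ i ∈ C, ∀ j ∈ C, Far i j → A5at K i j)

/-- `K` is an `A_n`-crystal (colors `1, …, n`). -/
def IsACrystal (n : ℕ) (K : PreGraph) : Prop := IsCrystalOn K (Set.Icc 1 n)

/-- Apply a list of operators, head first. -/
def applyStr (K : PreGraph) : List ℕ → K.V → Option K.V
  | [], v => some v
  | i :: L, v => (K.F i v).bind (applyStr K L)

/-- The string `w_{m,k,j} = F_{o+j} F_{o+j+1} ⋯ F_{o+j+k-1}` (rightmost applied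
first, i.e. head of the list applied first) for a crystal with colors `o+1, …, o+m`. -/
def wStr (o k j : ℕ) : List ℕ := (List.range k).map (fun m => o + j + k - 1 - m)

/-- The string `S_{m,k} = w_{m,k,m-k+1} ⋯ w_{m,k,2} w_{m,k,1}` for a crystal with
colors `o+1, …, o+m`. -/
def SStr (o m k : ℕ) : List ℕ :=
  (List.range (m - k + 1)).flatMap fun jm => wStr o k (jm + 1)

/-- The string `S_{m,m}^{a_{o+m}} ⋯ S_{m,1}^{a_{o+1}}` for a crystal with colors
`o+1, …, o+m`, defining the principal vertex with coordinates `a`. -/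
def prinStr (o m : ℕ) (a : ℕ → ℕ) : List ℕ :=
  (List.range m).flatMap fun km => (List.replicate (a (o + km + 1)) (SStr o m (km + 1))).flatten

def prinOpt (K : PreGraph) (o m : ℕ) (s : K.V) (a : ℕ → ℕ) : Option K.V :=
  applyStr K (prinStr o m a) s

/-- `p` is the principal vertex with coordinates `a` of the crystal `K` with colors
`o+1, …, o+m` and source `s`. -/
def IsPrin (K : PreGraph) (o m : ℕ) (s : K.V) (a : ℕ → ℕ) (p : K.V) : Prop :=
  prinOpt K o m s a = some p

/-- The principal lattice of an `A_n`-crystal with source `s` and parameter `c`. -/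
def PrinLat (K : PreGraph) (n : ℕ) (s : K.V) (c : ℕ → ℕ) : Set K.V :=
  {p | ∃ a : ℕ → ℕ, (∀ i, 1 ≤ i → i ≤ n → a i ≤ c i) ∧ IsPrin K 0 n s a p}

/-- One undirected step along an edge with color in `I`. -/
def stepOn (K : PreGraph) (I : Set ℕ) (u v : K.V) : Prop :=
  ∃ i ∈ I, K.F i u = some v ∨ K.F i v = some u

/-- `u` lies in the same `I`-colored component as `v`. -/
def inComp (K : PreGraph) (I : Set ℕ) (v u : K.V) : Prop :=
  Relation.ReflTransGen (stepOn K I) v u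

/-- The subcrystal of `K` with color set `I` containing `v` (the maximal connected
subgraph through `v` using only colors in `I`). -/
def PreGraph.sub (K : PreGraph) (I : Set ℕ) (v : K.V) : PreGraph where
  V := {u : K.V // inComp K I v u}
  F := fun i u =>
    if hi : i ∈ I then
      (K.F i u.1).pbind fun w hw =>
        some ⟨w, Relation.ReflTransGen.tail u.2 ⟨i, hi, Or.inl (Option.mem_def.mp hw)⟩⟩
    else none

/-- Directed reachability. -/
def dirReach (K : PreGraph) (u v : K.V) : Prop :=
  Relation.ReflTransGen (fun a b => ∃ i, K.F i a = some b) u v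

/-- The interval of `K` from `p` to `q`: the subgraph formed by all vertices and
edges lying on directed paths from `p` to `q`. -/
def PreGraph.interval (K : PreGraph) (p q : K.V) : PreGraph where
  V := {w : K.V // dirReach K p w ∧ dirReach K w q}
  F := fun i u =>
    (K.F i u.1).pbind fun w _ =>
      if hw : dirReach K p w ∧ dirReach K w q then some ⟨w, hw⟩ else none

/-- The symmetric extract: restriction to self-complementary vertices,
with `ibar`-edges given by `chain i`. -/
def extract (K : PreGraph) (chain : ℕ → K.V → Option K.V) (σ : K.V → K.V) : PreGraph where
  V := {v : K.V // σ v = v}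
  F := fun i u =>
    (chain i u.1).pbind fun w _ => if hw : σ w = w then some ⟨w, hw⟩ else none

/-- The operator chain for the color `ibar` of the symmetric extract of a
symmetric `A_{2n-1}`-crystal. -/
def chainB (K : PreGraph) (n : ℕ) (i : ℕ) (u : K.V) : Option K.V :=
  if 1 ≤ i ∧ i ≤ n then
    (if i = n then K.F n u else (K.F i u).bind (K.F (2 * n - i)))
  else none

/-- The operator chain for the color `ibar` of the symmetric extract of a
symmetric `A_{2n}`-crystal. -/
def chainC (K : PreGraph) (n : ℕ) (i : ℕ) (u : K.V) : Option K.V :=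
  if 1 ≤ i ∧ i ≤ n then
    (if i = n then (((K.F n u).bind (K.F (n + 1))).bind (K.F (n + 1))).bind (K.F n)
     else (K.F i u).bind (K.F (2 * n + 1 - i)))
  else none

/-- Symmetric extract from a symmetric `A_{2n-1}`-crystal. -/
def extractB (K : PreGraph) (n : ℕ) (σ : K.V → K.V) : PreGraph := extract K (chainB K n) σ

/-- Symmetric extract from a symmetric `A_{2n}`-crystal. -/
def extractC (K : PreGraph) (n : ℕ) (σ : K.V → K.V) : PreGraph := extract K (chainC K n) σ

/-- Admissibility of a six-tuple `(x', y, x''; y', x, y'')` in the worm model. -/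
def WormOK (g1 g2 : ℕ) : ℤ × ℤ × ℤ × ℤ × ℤ × ℤ → Prop
  | (x', y, x'', y', x, y'') =>
    (0 ≤ x' ∧ x' ≤ 2 * (g1 : ℤ)) ∧ (0 ≤ x'' ∧ x'' ≤ 2 * (g1 : ℤ)) ∧
    (0 ≤ x ∧ x ≤ 2 * (g1 : ℤ)) ∧
    (0 ≤ y' ∧ y' ≤ (g2 : ℤ)) ∧ (0 ≤ y'' ∧ y'' ≤ (g2 : ℤ)) ∧ (0 ≤ y ∧ y ≤ (g2 : ℤ)) ∧
    (2 ∣ x') ∧ (2 ∣ x'') ∧ (y' ≤ y ∧ y ≤ y'') ∧ (x' ≤ x ∧ x ≤ x'') ∧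
    (y' < y → x' = x) ∧ (y < y'' → x = x'')

/-- The candidate image of a worm under the operator `1tilde`. -/
def worm1 : ℤ × ℤ × ℤ × ℤ × ℤ × ℤ → ℤ × ℤ × ℤ × ℤ × ℤ × ℤ
  | (x', y, x'', y', x, y'') =>
    if 2 * x > x' + x'' then (x' + 2, y, x'', y', x, y'')
    else if x = x' ∧ x' = x'' ∧ y < y'' then (x', y + 1, x'', y', x, y'')
    else (x', y, x'' + 2, y', x, y'')

/-- The candidate image of a worm under the operator `2tilde`. -/
def worm2 : ℤ × ℤ × ℤ × ℤ × ℤ × ℤ → ℤ × ℤ × ℤ × ℤ × ℤ × ℤ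
  | (x', y, x'', y', x, y'') =>
    if 2 * y > y' + y'' then (x', y, x'', y' + 1, x, y'')
    else if y' = y ∧ y = y'' ∧ x < x'' then (x', y, x'', y', x + 1, y'')
    else (x', y, x'', y', x, y'' + 1)

/-- The worm graph `W(g1, g2)`, with colors `1 = 1tilde` and `2 = 2tilde`. -/
def WormGraph (g1 g2 : ℕ) : PreGraph where
  V := {w : ℤ × ℤ × ℤ × ℤ × ℤ × ℤ // WormOK g1 g2 w}
  F := fun i u =>
    if i = 1 then
      (if h1 : WormOK g1 g2 (worm1 u.1) then some ⟨worm1 u.1, h1⟩ else none)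
    else if i = 2 then
      (if h2 : WormOK g1 g2 (worm2 u.1) then some ⟨worm2 u.1, h2⟩ else none)
    else none

/-- Isomorphism of colored graphs, renaming colors via `φ`. -/
def IsoVia (K L : PreGraph) (φ : ℕ → ℕ) : Prop :=
  ∃ e : K.V ≃ L.V, ∀ i u v, K.F i u = some v ↔ L.F (φ i) (e u) = some (e v)

/-- The Cartesian product of an `i`-path of length `p` and a `j`-path of length `q`. -/
def boxGraph (i j p q : ℕ) : PreGraph where
  V := Fin (p + 1) × Fin (q + 1)
  F := fun s u =>
    if s = i then
      (if h : (u.1 : ℕ) < p then some (⟨(u.1 : ℕ) + 1, by omega⟩, u.2) else none)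
    else if s = j then
      (if h : (u.2 : ℕ) < q then some (u.1, ⟨(u.2 : ℕ) + 1, by omega⟩) else none)
    else none

/-- `B_n`-crystal: components with colors `n-1, n` are worm graphs,
with color `n-1` corresponding to `1tilde` and `n` to `2tilde`. -/
def IsBCrystal (n : ℕ) (B : PreGraph) : Prop :=
  IsColored B (Set.Icc 1 n) ∧ B.Connected ∧
  (∀ i ∈ Set.Icc 1 n, ∀ j ∈ Set.Icc 1 n, Far i j → A5at B i j) ∧
  (∀ i j, 1 ≤ i → i < n → 1 ≤ j → j < n → Neighb i j →
    ∀ v : B.V, IsCrystalOn (B.sub {i, j} v) {i, j}) ∧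
  (∀ v : B.V, ∃ g1 g2 : ℕ,
    IsoVia (B.sub ({n - 1, n} : Set ℕ) v) (WormGraph g1 g2)
      (fun x => if x = n - 1 then 1 else if x = n then 2 else 0))

/-- `C_n`-crystal: components with colors `n-1, n` are worm graphs,
with color `n-1` corresponding to `2tilde` and `n` to `1tilde`. -/
def IsCCrystal (n : ℕ) (B : PreGraph) : Prop :=
  IsColored B (Set.Icc 1 n) ∧ B.Connected ∧
  (∀ i ∈ Set.Icc 1 n, ∀ j ∈ Set.Icc 1 n, Far i j → A5at B i j) ∧
  (∀ i j, 1 ≤ i → i < n → 1 ≤ j → j < n → Neighb i j →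
    ∀ v : B.V, IsCrystalOn (B.sub {i, j} v) {i, j}) ∧
  (∀ v : B.V, ∃ g1 g2 : ℕ,
    IsoVia (B.sub ({n - 1, n} : Set ℕ) v) (WormGraph g1 g2)
      (fun x => if x = n - 1 then 2 else if x = n then 1 else 0))

/-! ### The crossing model -/

/-- `(k, i, j)` is a node `v_i^k(j)` of the supporting graph `G` for rank `n`. -/
def isNode (n k i j : ℕ) : Prop :=
  1 ≤ j ∧ j ≤ i ∧ i ≤ n ∧ i - j + 1 ≤ k ∧ k ≤ n - j + 1

instance (n k i j : ℕ) : Decidable (isNode n k i j) := by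
  unfold isNode; infer_instance

/-- Extension of a function on the nodes of `G` to the extended supporting graph:
extra nodes from which `G^k` is reachable get value `c k`, the others get `0`. -/
def fext (n : ℕ) (c : ℕ → ℕ) (f : ℕ × ℕ × ℕ → ℤ) (k i j : ℕ) : ℤ :=
  if isNode n k i j then f (k, i, j)
  else if j ≤ n - k + 1 then (c k : ℤ) else 0

/-- The slack at the node `v_i^k(j)`. -/
def epsN (n : ℕ) (c : ℕ → ℕ) (f : ℕ × ℕ × ℕ → ℤ) (k i j : ℕ) : ℤ :=
  (fext n c f k (i - 1) (j - 1) - fext n c f k i j) -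
    (fext n c f k i (j - 1) - fext n c f k (i + 1) j)

/-- The total slack at the multinode `V_i(j)`. -/
def epsTot (n : ℕ) (c : ℕ → ℕ) (f : ℕ × ℕ × ℕ → ℤ) (i j : ℕ) : ℤ :=
  ∑ k ∈ Finset.Icc (i - j + 1) (n - j + 1), epsN n c f k i j

/-- The reduced slack at the multinode `V_i(j)`. -/
def teps (n : ℕ) (c : ℕ → ℕ) (f : ℕ × ℕ × ℕ → ℤ) (i j : ℕ) : ℤ :=
  if hj : (Finset.Icc 1 j).Nonempty then
    max 0 ((Finset.Icc 1 j).inf' hj fun p => ∑ q ∈ Finset.Icc p j, epsTot n c f i q)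
  else 0

/-- `k0` satisfies the switch condition in the multinode `V_i(j)`. -/
def switchCond (n : ℕ) (f : ℕ × ℕ × ℕ → ℤ) (i j k0 : ℕ) : Prop :=
  i - j + 1 ≤ k0 ∧ k0 ≤ n - j + 1 ∧
  (∀ k, i - j + 1 ≤ k → k < k0 → isNode n k (i + 1) (j + 1) →
    f (k, i, j) = f (k, i + 1, j + 1)) ∧
  (∀ k, k0 < k → k ≤ n - j + 1 → isNode n k (i + 1) j →
    f (k, i + 1, j) = f (k, i, j))

/-- The switch-node (first node with the switch property) of the multinode `V_i(j)`. -/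
def switchNode (n : ℕ) (f : ℕ × ℕ × ℕ → ℤ) (i j : ℕ) : ℕ :=
  sInf {k0 | switchCond n f i j k0}

/-- Feasible functions of the crossing model (normalized to vanish off the nodes). -/
def Feasible (n : ℕ) (c : ℕ → ℕ) (f : ℕ × ℕ × ℕ → ℤ) : Prop :=
  (∀ k i j, ¬ isNode n k i j → f (k, i, j) = 0) ∧
  (∀ k i j, isNode n k i j → isNode n k (i - 1) j → f (k, i - 1, j) ≤ f (k, i, j)) ∧
  (∀ k i j, isNode n k i j → isNode n k (i + 1) (j + 1) → f (k, i + 1, j + 1) ≤ f (k, i, j)) ∧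
  (∀ k i j, isNode n k i j → 0 ≤ f (k, i, j) ∧ f (k, i, j) ≤ (c k : ℤ)) ∧
  (∀ i j, 1 ≤ j → j ≤ i → i ≤ n → ∃ k0, switchCond n f i j k0)

/-- Increase `f` by one at the node `(k, i, j)`. -/
def bump (f : ℕ × ℕ × ℕ → ℤ) (k i j : ℕ) : ℕ × ℕ × ℕ → ℤ :=
  fun x => if x = (k, i, j) then f x + 1 else f x

/-- The crossing-model graph `Kscr(c)`: vertices are the feasible functions, and
the move `φ_i` increases `f` by one at the switch-node of the active multinode. -/
def Kscr (n : ℕ) (c : ℕ → ℕ) : PreGraph where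
  V := {f : ℕ × ℕ × ℕ → ℤ // Feasible n c f}
  F := fun i f =>
    if 1 ≤ i ∧ i ≤ n ∧ ∃ j, 1 ≤ j ∧ j ≤ i ∧ 0 < teps n c f.1 i j then
      (let j := sSup {j | 1 ≤ j ∧ j ≤ i ∧ 0 < teps n c f.1 i j}
       let g := bump f.1 (switchNode n f.1 i j) i j
       if hg : Feasible n c g then some ⟨g, hg⟩ else none)
    else none

/-- The function `f_{a,D}` of the crossing model. -/
def faD (n : ℕ) (a : ℕ → ℕ) (D : ℕ → ℤ) : ℕ × ℕ × ℕ → ℤ := fun x =>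
  if isNode n x.1 x.2.1 x.2.2 then
    (if x.2.1 - x.2.2 + 1 = x.1 then (a x.1 : ℤ) else (a x.1 : ℤ) + min (D (x.1 - 1)) 0) +
    (if x.2.2 ≤ n - x.1 then max (D x.1) 0 else 0)
  else 0

/-! ### Descriptions of self-complementary vertices -/

/-- `(a1, a2, δ, l)` is the description of a self-complementary vertex `v` of a
symmetric `A_3`-crystal `K` with source `s` and parameter `c`. -/
def IsDescB (K : PreGraph) (s : K.V) (c : ℕ → ℕ) (v : K.V) (q : ℕ × ℕ × ℤ × ℕ) : Prop :=
  q.2.2.2 = K.t 2 v ∧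
  ∃ (a : ℕ → ℕ) (pa : K.V),
    a 1 = q.1 ∧ a 2 = q.2.1 ∧ a 3 = ((q.1 : ℤ) + max q.2.2.1 0).toNat ∧
    (∀ i, 1 ≤ i → i ≤ 3 → a i ≤ c i) ∧
    IsPrin K 0 3 s a pa ∧ inComp K (Set.Icc 1 2) pa v ∧
    0 ≤ (q.2.1 : ℤ) + q.2.2.1 ∧ 0 ≤ (a 3 : ℤ) - q.2.2.1 ∧
    ∃ s' : (K.sub (Set.Icc 1 2) pa).V, IsSource (K.sub (Set.Icc 1 2) pa) s' ∧
    ∃ z : (K.sub (Set.Icc 1 2) pa).V,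
      IsPrin (K.sub (Set.Icc 1 2) pa) 0 2 s'
        (fun i => if i = 1 then ((q.2.1 : ℤ) + q.2.2.1).toNat else ((a 3 : ℤ) - q.2.2.1).toNat) z ∧
      inComp K ({2} : Set ℕ) z.1 v

/-- The polytope of descriptions for a symmetric `A_3`-crystal with parameter `(c1, c2, c1)`. -/
def QuadB (c1 c2 : ℕ) : Set (ℕ × ℕ × ℤ × ℕ) :=
  {q | q.1 ≤ c1 ∧ q.2.1 ≤ c2 ∧ -(q.2.1 : ℤ) ≤ q.2.2.1 ∧ (q.2.1 : ℤ) - (c2 : ℤ) ≤ q.2.2.1 ∧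
       q.2.2.1 ≤ (c1 : ℤ) - (q.1 : ℤ) ∧ (q.2.2.2 : ℤ) ≤ (c2 : ℤ) + 2 * q.2.2.1}

/-- The worm associated to the description `(a1, a2, δ, l)`. -/
def wtupleB (a1 a2 : ℕ) (δ : ℤ) (l : ℕ) : ℤ × ℤ × ℤ × ℤ × ℤ × ℤ :=
  let a3 : ℤ := (a1 : ℤ) + max δ 0
  let tr : ℤ × ℤ × ℤ :=
    if 0 ≤ δ then
      if (l : ℤ) ≤ (a2 : ℤ) then ((l : ℤ), 2 * (a1 : ℤ), (a2 : ℤ))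
      else if (l : ℤ) ≤ (a2 : ℤ) + 2 * δ then
        ((a2 : ℤ), 2 * (a1 : ℤ) + (l : ℤ) - (a2 : ℤ), (a2 : ℤ))
      else ((a2 : ℤ), 2 * a3, (l : ℤ) - 2 * δ)
    else
      if (l : ℤ) ≤ (a2 : ℤ) + δ then ((l : ℤ), 2 * (a1 : ℤ), (a2 : ℤ) - δ)
      else ((a2 : ℤ) + δ, 2 * (a1 : ℤ), (l : ℤ) - 2 * δ)
  (2 * (a1 : ℤ), (a2 : ℤ), 2 * a3, tr.1, tr.2.1, tr.2.2)

def wtQ (q : ℕ × ℕ × ℤ × ℕ) : ℤ × ℤ × ℤ × ℤ × ℤ × ℤ :=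
  wtupleB q.1 q.2.1 q.2.2.1 q.2.2.2

/-- The string `(F_2 F_3)^r (F_3 F_2)^r` (rightmost applied first). -/
def diagStr (r : ℕ) : List ℕ :=
  (List.replicate r ([2, 3] : List ℕ)).flatten ++ (List.replicate r ([3, 2] : List ℕ)).flatten

/-- `(a1, a2, δ, ρ)` is the description of a self-complementary vertex `v` of a
symmetric `A_4`-crystal `K` with source `s` and parameter `c`. -/
def IsDescC (K : PreGraph) (s : K.V) (c : ℕ → ℕ) (v : K.V) (q : ℕ × ℕ × ℤ × ℕ) : Prop :=
  ∃ (a : ℕ → ℕ) (pa : K.V),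
    a 1 = q.1 ∧ a 2 = q.2.1 ∧ a 3 = ((q.2.1 : ℤ) + min q.2.2.1 0).toNat ∧
    a 4 = ((q.1 : ℤ) + max q.2.2.1 0).toNat ∧
    (∀ i, 1 ≤ i → i ≤ 4 → a i ≤ c i) ∧
    IsPrin K 0 4 s a pa ∧ inComp K (Set.Icc 1 3) pa v ∧
    0 ≤ (q.2.1 : ℤ) + q.2.2.1 ∧ 0 ≤ (a 4 : ℤ) - q.2.2.1 ∧
    (∃ s' : (K.sub (Set.Icc 1 3) pa).V, IsSource (K.sub (Set.Icc 1 3) pa) s' ∧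
     ∃ z : (K.sub (Set.Icc 1 3) pa).V,
       IsPrin (K.sub (Set.Icc 1 3) pa) 0 3 s'
         (fun i => if i = 1 then ((q.2.1 : ℤ) + q.2.2.1).toNat
                   else if i = 2 then a 3 else ((a 4 : ℤ) - q.2.2.1).toNat) z ∧
       inComp K (Set.Icc 2 3) z.1 v) ∧
    (∃ stil : (K.sub (Set.Icc 2 3) v).V, IsSource (K.sub (Set.Icc 2 3) v) stil ∧
       applyStr (K.sub (Set.Icc 2 3) v) (diagStr q.2.2.2) stil =
         some ⟨v, Relation.ReflTransGen.refl⟩)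

/-- The polytope of descriptions for a symmetric `A_4`-crystal with parameter
`(c1, c2, c2, c1)`. -/
def QuadC (c1 c2 : ℕ) : Set (ℕ × ℕ × ℤ × ℕ) :=
  {q | q.1 ≤ c1 ∧ q.2.1 ≤ c2 ∧ -(q.2.1 : ℤ) ≤ q.2.2.1 ∧
       q.2.2.1 ≤ (c1 : ℤ) - (q.1 : ℤ) ∧ (q.2.2.2 : ℤ) ≤ (c2 : ℤ) + q.2.2.1}

end

/-! ### Local axioms in relational form -/

/-- The local axioms of a regular crystal of type `A_N`, for an edge relation `E` with
string-length functions `h` (outgoing) and `t` (incoming). -/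
structure LocalCrystal {V : Type} (N : ℕ) (E : ℕ → V → V → Prop) (h t : ℕ → V → ℤ) : Prop where
  out_unique : ∀ {i u v v'}, i ∈ Set.Icc 1 N → E i u v → E i u v' → v = v'
  in_unique : ∀ {i u u' v}, i ∈ Set.Icc 1 N → E i u v → E i u' v → u = u'
  t_nonneg : ∀ {i} u, i ∈ Set.Icc 1 N → 0 ≤ t i u
  exists_out : ∀ {i u}, i ∈ Set.Icc 1 N → (0 < h i u ↔ ∃ v, E i u v)
  exists_in : ∀ {i v}, i ∈ Set.Icc 1 N → (0 < t i v ↔ ∃ u, E i u v)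
  same : ∀ {i u v}, i ∈ Set.Icc 1 N → E i u v → h i v = h i u - 1 ∧ t i v = t i u + 1
  far : ∀ {i j u v}, i ∈ Set.Icc 1 N → j ∈ Set.Icc 1 N → Far i j → E i u v →
    h j v = h j u ∧ t j v = t j u
  near : ∀ {i j u v}, i ∈ Set.Icc 1 N → j ∈ Set.Icc 1 N → Neighb i j → E i u v →
    (h j v = h j u + 1 ∧ t j v = t j u) ∨ (h j v = h j u ∧ t j v = t j u - 1)
  far_down : ∀ {i j u v v'}, i ∈ Set.Icc 1 N → j ∈ Set.Icc 1 N → Far i j → E i u v → E j u v' →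
    ∃ w, E j v w ∧ E i v' w
  far_up : ∀ {i j u u' v}, i ∈ Set.Icc 1 N → j ∈ Set.Icc 1 N → Far i j → E i u v → E j u' v →
    ∃ w, E j w u ∧ E i w u'
  near_down : ∀ {i j u v v'}, i ∈ Set.Icc 1 N → j ∈ Set.Icc 1 N → Neighb i j →
    E i u v → E j u v' → h j v = h j u → h i v' = h i u + 1 ∧ ∃ w, E j v w ∧ E i v' w
  near_up : ∀ {i j u u' v}, i ∈ Set.Icc 1 N → j ∈ Set.Icc 1 N → Neighb i j →
    E i u v → E j u' v → h j v = h j u + 1 → h i v = h i u' ∧ ∃ w, E j w u ∧ E i w u'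
  verma_down : ∀ {i j u v v'}, i ∈ Set.Icc 1 N → j ∈ Set.Icc 1 N → Neighb i j →
    E i u v → E j u v' → h j v = h j u + 1 → h i v' = h i u + 1 →
    ∃ x y x' y' w, E j v x ∧ E j x y ∧ E i y w ∧ E i v' x' ∧ E i x' y' ∧ E j y' w
  verma_up : ∀ {i j u u' v}, i ∈ Set.Icc 1 N → j ∈ Set.Icc 1 N → Neighb i j →
    E i u v → E j u' v → h j v = h j u → h i v = h i u' →
    ∃ x y x' y' w, E j x u ∧ E j y x ∧ E i w y ∧ E i x' u' ∧ E i y' x' ∧ E j w y'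

theorem Neighb.symm {i j : ℕ} (hij : Neighb i j) : Neighb j i := Or.symm hij

theorem Far.symm {i j : ℕ} (hij : Far i j) : Far j i := Or.symm hij

theorem eq_or_neighb_or_far (i j : ℕ) : i = j ∨ Neighb i j ∨ Far i j := by
  unfold Neighb Far; omega

/-- Directed reachability along edges with colors `1, …, N`. -/
def Reach {V : Type} (N : ℕ) (E : ℕ → V → V → Prop) : V → V → Prop :=
  Relation.ReflTransGen fun a b => ∃ i ∈ Set.Icc 1 N, E i a b

/-- A vertex all of whose incoming strings are trivial. -/
def IsHighest {V : Type} (N : ℕ) (t : ℕ → V → ℤ) (s : V) : Prop := ∀ i ∈ Set.Icc 1 N, t i s = 0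

/-- A multiple of the pairing of the weight of `v` with the half-sum of positive coroots. -/
def crystalRank {V : Type} (N : ℕ) (h t : ℕ → V → ℤ) (v : V) : ℤ :=
  ∑ j ∈ Finset.Icc 1 N, (j : ℤ) * ((N : ℤ) + 1 - j) * (h j v - t j v)

namespace LocalCrystal

variable {V : Type} {N : ℕ} {E : ℕ → V → V → Prop} {h t : ℕ → V → ℤ}

theorem rank_edge (L : LocalCrystal N E h t) {i : ℕ} {u v : V} (hi : i ∈ Set.Icc 1 N)
    (e : E i u v) : crystalRank N h t v = crystalRank N h t u - 2 := by
  have key : ∀ j ∈ Finset.Icc 1 N, (j : ℤ) * ((N : ℤ) + 1 - j) * (h j v - t j v) =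
      (j : ℤ) * ((N : ℤ) + 1 - j) * (h j u - t j u) +
      ((if j = i then (-2) * ((i : ℤ) * ((N : ℤ) + 1 - i)) else 0) +
      (if j = i - 1 then ((i : ℤ) - 1) * ((N : ℤ) + 1 - (i - 1)) else 0) +
      (if j = i + 1 then ((i : ℤ) + 1) * ((N : ℤ) + 1 - (i + 1)) else 0)) := by
    intro j hj
    have hj' : j ∈ Set.Icc 1 N := by simpa using hj
    have h1 : 1 ≤ i := hi.1
    rcases eq_or_neighb_or_far i j with rfl | hn | hf
    · have hs := L.same hi e
      have n1 : i ≠ i - 1 := by omega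
      have n2 : i ≠ i + 1 := by omega
      simp only [if_true, if_neg n1, if_neg n2, hs.1, hs.2]
      ring
    · have hs : h j v - t j v = h j u - t j u + 1 := by
        rcases L.near hi hj' hn e with hs | hs <;> omega
      rw [hs]
      rcases hn with hn | hn
      · subst hn
        have n1 : i + 1 ≠ i := by omega
        have n2 : i + 1 ≠ i - 1 := by omega
        simp only [if_true, if_neg n1, if_neg n2]
        push_cast
        ring
      · subst hn
        have n1 : j ≠ j + 1 := by omega
        have n2 : j ≠ j + 1 + 1 := by omega
        have n3 : j = j + 1 - 1 := by omega
        simp only [if_neg n1, if_neg n2, if_pos n3]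
        push_cast
        ring
    · have hs := L.far hi hj' hf e
      have n1 : j ≠ i := by unfold Far at hf; omega
      have n2 : j ≠ i - 1 := by unfold Far at hf; omega
      have n3 : j ≠ i + 1 := by unfold Far at hf; omega
      simp only [if_neg n1, if_neg n2, if_neg n3, hs.1, hs.2]
      ring
  unfold crystalRank
  rw [Finset.sum_congr rfl key, Finset.sum_add_distrib, Finset.sum_add_distrib,
    Finset.sum_add_distrib, Finset.sum_ite_eq', Finset.sum_ite_eq', Finset.sum_ite_eq']
  have h1 : 1 ≤ i := hi.1
  have h2 : i ≤ N := hi.2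
  have m1 : (if i - 1 ∈ Finset.Icc 1 N then ((i : ℤ) - 1) * ((N : ℤ) + 1 - (i - 1)) else 0) =
      ((i : ℤ) - 1) * ((N : ℤ) + 1 - (i - 1)) := by
    split_ifs with hm
    · rfl
    · have : i = 1 := by simp at hm; omega
      subst this; simp
  have m2 : (if i + 1 ∈ Finset.Icc 1 N then ((i : ℤ) + 1) * ((N : ℤ) + 1 - (i + 1)) else 0) =
      ((i : ℤ) + 1) * ((N : ℤ) + 1 - (i + 1)) := by
    split_ifs with hm
    · rfl
    · have : i = N := by simp at hm; omega
      subst this; simp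
  rw [if_pos (by simpa using hi), m1, m2]
  ring

theorem rank_le_of_reach (L : LocalCrystal N E h t) {u v : V} (r : Reach N E u v) :
    crystalRank N h t v ≤ crystalRank N h t u := by
  induction r with
  | refl => exact le_rfl
  | tail _ e ih =>
    obtain ⟨i, hi, e⟩ := e
    have := L.rank_edge hi e
    omega

theorem no_in_of_highest (L : LocalCrystal N E h t) {s u : V} (hs : IsHighest N t s) {i : ℕ}
    (hi : i ∈ Set.Icc 1 N) : ¬ E i u s := by
  intro e
  have := (L.exists_in hi).2 ⟨u, e⟩
  have := hs i hi
  omega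

theorem eq_of_reach_top (L : LocalCrystal N E h t) {s u : V} (hs : IsHighest N t s)
    (r : Reach N E u s) : u = s := by
  rcases Relation.ReflTransGen.cases_tail r with h | ⟨_, _, i, hi, e⟩
  · exact h.symm
  · exact absurd e (no_in_of_highest L hs hi)

theorem exists_top (L : LocalCrystal N E h t) [Finite V] (v : V) :
    ∃ s, IsHighest N t s ∧ Reach N E s v := by
  obtain ⟨s, hs, hmax⟩ := Set.exists_max_image {x | Reach N E x v} (crystalRank N h t)
    (Set.toFinite _) ⟨v, Relation.ReflTransGen.refl⟩
  refine ⟨s, fun i hi => ?_, hs⟩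
  by_contra hne
  obtain ⟨u, e⟩ := (L.exists_in hi).1 (lt_of_le_of_ne (L.t_nonneg s hi) (Ne.symm hne))
  have h1 := hmax u (Relation.ReflTransGen.head ⟨i, hi, e⟩ hs)
  have h2 := L.rank_edge hi e
  omega

theorem common_ancestor (L : LocalCrystal N E h t) {i j : ℕ} {x z v : V} (hi : i ∈ Set.Icc 1 N)
    (hj : j ∈ Set.Icc 1 N) (hij : i ≠ j) (e : E i x v) (e' : E j z v) :
    ∃ w, Reach N E w x ∧ Reach N E w z := by
  have one : ∀ {k a b}, k ∈ Set.Icc 1 N → E k a b → Reach N E a b :=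
    fun hk ek => Relation.ReflTransGen.single ⟨_, hk, ek⟩
  rcases eq_or_neighb_or_far i j with hh | hn | hf
  · exact absurd hh hij
  · rcases L.near hi hj hn e with ⟨h1, -⟩ | ⟨h1, -⟩
    · obtain ⟨-, w, a, b⟩ := L.near_up hi hj hn e e' h1
      exact ⟨w, one hj a, one hi b⟩
    · rcases L.near hj hi hn.symm e' with ⟨h2, -⟩ | ⟨h2, -⟩
      · obtain ⟨-, w, a, b⟩ := L.near_up hj hi hn.symm e' e h2
        exact ⟨w, one hj b, one hi a⟩
      · obtain ⟨_, _, _, _, w, a, b, c, a', b', c'⟩ := L.verma_up hi hj hn e e' h1 h2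
        exact ⟨w, (one hi c).trans ((one hj b).trans (one hj a)),
          (one hj c').trans ((one hi b').trans (one hi a'))⟩
  · obtain ⟨w, a, b⟩ := L.far_up hi hj hf e e'
    exact ⟨w, one hj a, one hi b⟩

theorem top_unique_of_reach (L : LocalCrystal N E h t) [Finite V] {s s' v : V}
    (hs : IsHighest N t s) (hs' : IsHighest N t s') (r : Reach N E s v) (r' : Reach N E s' v) :
    s = s' := by
  suffices H : ∀ (d : ℕ) (v s' : V), crystalRank N h t s ≤ crystalRank N h t v + 2 * d →
      IsHighest N t s' →
      Reach N E s v → Reach N E s' v → s = s' from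
    H (crystalRank N h t s - crystalRank N h t v).toNat v s' (by omega) hs' r r'
  intro d
  induction d with
  | zero =>
    intro v s' hd hs' r r'
    rcases Relation.ReflTransGen.cases_tail r with h | ⟨x, rx, i, hi, e⟩
    · subst h
      exact (L.eq_of_reach_top hs r').symm
    · have h1 := L.rank_le_of_reach rx
      have h2 := L.rank_edge hi e
      omega
  | succ d ih =>
    intro v s' hd hs' r r'
    rcases Relation.ReflTransGen.cases_tail r with h | ⟨x, rx, i, hi, e⟩
    · subst h
      exact (L.eq_of_reach_top hs r').symm
    · rcases Relation.ReflTransGen.cases_tail r' with h | ⟨z, rz, j, hj, e'⟩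
      · subst h
        exact absurd e (no_in_of_highest L hs' hi)
      · have hx := L.rank_edge hi e
        have hz := L.rank_edge hj e'
        by_cases hij : i = j
        · subst hij
          have := L.in_unique hi e e'
          subst this
          exact ih x s' (by push_cast at hd; omega) hs' rx rz
        · obtain ⟨w, wx, wz⟩ := L.common_ancestor hi hj hij e e'
          obtain ⟨s'', hs'', rw⟩ := L.exists_top w
          have h1 := ih x s'' (by push_cast at hd; omega) hs'' rx (rw.trans wx)
          subst h1
          exact ih z s' (by push_cast at hd; omega) hs' (rw.trans wz) rz

/-- In a connected part of a finite regular crystal the source is unique. -/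
theorem top_unique (L : LocalCrystal N E h t) [Finite V] {u v s s' : V}
    (c : Relation.ReflTransGen (fun a b => ∃ i ∈ Set.Icc 1 N, E i a b ∨ E i b a) u v)
    (hs : IsHighest N t s) (hs' : IsHighest N t s') (r : Reach N E s u) (r' : Reach N E s' v) :
    s = s' := by
  induction c generalizing s' with
  | refl => exact L.top_unique_of_reach hs hs' r r'
  | @tail b c' _ e ih =>
    obtain ⟨i, hi, e | e⟩ := e
    · obtain ⟨s'', hs'', r''⟩ := L.exists_top b
      rw [ih hs'' r'']
      exact L.top_unique_of_reach hs'' hs' (r''.tail ⟨i, hi, e⟩) r'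
    · exact ih hs' (r'.tail ⟨i, hi, e⟩)

end LocalCrystal

/-! ### Uniqueness of a regular crystal with given parameters -/

/-- Pairs of vertices obtained from the base points by the same string of `d` operators. -/
inductive Match {V W : Type} (N : ℕ) (E : ℕ → V → V → Prop) (E' : ℕ → W → W → Prop)
    (s : V) (s' : W) : ℕ → V → W → Prop
  | base : Match N E E' s s' 0 s s'
  | step {d i u u' v v'} : Match N E E' s s' d u u' → i ∈ Set.Icc 1 N → E i u v → E' i u' v' →
      Match N E E' s s' (d + 1) v v'

theorem Match.swap {V W : Type} {N : ℕ} {E : ℕ → V → V → Prop} {E' : ℕ → W → W → Prop}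
    {s : V} {s' : W} {d : ℕ} {u : V} {u' : W} (m : Match N E E' s s' d u u') :
    Match N E' E s' s d u' u := by
  induction m with
  | base => exact .base
  | step _ hi e e' ih => exact ih.step hi e' e

section

variable {V W : Type} {N : ℕ} {E : ℕ → V → V → Prop} {E' : ℕ → W → W → Prop}
  {h t : ℕ → V → ℤ} {h' t' : ℕ → W → ℤ} {s : V} {s' : W}

theorem Match.rank_eq (L : LocalCrystal N E h t) {d : ℕ} {u : V} {u' : W}
    (m : Match N E E' s s' d u u') : crystalRank N h t u = crystalRank N h t s - 2 * d := by
  induction m with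
  | base => simp
  | step _ hi e _ ih =>
    rw [L.rank_edge hi e, ih]
    push_cast
    ring

/-- The string lengths of `u` and `u'` agree. -/
def SameStrings (N : ℕ) (h t : ℕ → V → ℤ) (h' t' : ℕ → W → ℤ) (u : V) (u' : W) : Prop :=
  ∀ i ∈ Set.Icc 1 N, h i u = h' i u' ∧ t i u = t' i u'

theorem SameStrings.swap {u : V} {u' : W} (hs : SameStrings N h t h' t' u u') :
    SameStrings N h' t' h t u' u := fun i hi => ⟨(hs i hi).1.symm, (hs i hi).2.symm⟩

/-- The matching is a string-preserving partial bijection up to depth `d`. -/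
def GoodMatch (N : ℕ) (E : ℕ → V → V → Prop) (E' : ℕ → W → W → Prop)
    (h t : ℕ → V → ℤ) (h' t' : ℕ → W → ℤ) (s : V) (s' : W) (d : ℕ) : Prop :=
  ∀ u u', Match N E E' s s' d u u' →
    SameStrings N h t h' t' u u' ∧
    (∀ w', Match N E E' s s' d u w' → w' = u') ∧
    (∀ w, Match N E E' s s' d w u' → w = u) ∧
    (∀ i ∈ Set.Icc 1 N, ∀ z, E i z u → ∃ d' z', d = d' + 1 ∧ E' i z' u' ∧
      Match N E E' s s' d' z z') ∧
    (∀ i ∈ Set.Icc 1 N, ∀ z', E' i z' u' → ∃ d' z, d = d' + 1 ∧ E i z u ∧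
      Match N E E' s s' d' z z')

theorem GoodMatch.swap {d : ℕ} (g : GoodMatch N E E' h t h' t' s s' d) :
    GoodMatch N E' E h' t' h t s' s d := by
  intro u' u m
  obtain ⟨a, b, c, d1, d2⟩ := g u u' m.swap
  refine ⟨a.swap, fun w hw => c w hw.swap, fun w hw => b w hw.swap, ?_, ?_⟩
  · intro i hi z' e
    obtain ⟨d', z, hd, ez, mz⟩ := d2 i hi z' e
    exact ⟨d', z, hd, ez, mz.swap⟩
  · intro i hi z e
    obtain ⟨d', z', hd, ez, mz⟩ := d1 i hi z e
    exact ⟨d', z', hd, ez, mz.swap⟩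

/-- The labels at the upper vertex of a Verma relation whose lower labels vanish. -/
theorem LocalCrystal.verma_up_label (L : LocalCrystal N E h t) {i j : ℕ} {u u' v x y x' y' w : V}
    (hi : i ∈ Set.Icc 1 N) (hj : j ∈ Set.Icc 1 N) (hij : Neighb i j)
    (e : E i u v) (e' : E j u' v) (h1 : h j v = h j u) (h2 : h i v = h i u')
    (a : E j x u) (b : E j y x) (c : E i w y) (a' : E i x' u') (b' : E i y' x') (c' : E j w y') :
    h j y = h j w + 1 := by
  rcases L.near hi hj hij c with ⟨h3, -⟩ | ⟨h3, -⟩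
  · exact h3
  · exfalso
    obtain ⟨-, z, z1, z2⟩ := L.near_down hi hj hij c c' h3
    obtain rfl := L.out_unique hj z1 b
    obtain rfl := L.out_unique hi z2 b'
    have s1 := L.same hj a
    have s2 := L.same hi a'
    have s3 := L.same hi e
    have s4 := L.same hj e'
    obtain ⟨h4, -⟩ := L.near_down hj hi hij.symm a a' (by omega)
    omega

theorem match_lift (L : LocalCrystal N E h t) (L' : LocalCrystal N E' h' t')
    {d : ℕ} (ih : ∀ k ≤ d, GoodMatch N E E' h t h' t' s s' k)
    {i : ℕ} {x u : V} {x' u' : W} (m : Match N E E' s s' d x x') (hi : i ∈ Set.Icc 1 N)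
    (e : E i x u) (e' : E' i x' u') {j : ℕ} (hj : j ∈ Set.Icc 1 N) {z : V} (ez : E j z u) :
    ∃ z', E' j z' u' ∧ Match N E E' s s' d z z' := by
  have down : ∀ {k a a' b l}, k ≤ d → Match N E E' s s' k a a' → l ∈ Set.Icc 1 N → E l a b →
      ∃ b', E' l a' b' ∧ Match N E E' s s' (k + 1) b b' := by
    intro k a a' b l hk ma hl ea
    have hs := (ih k hk a a' ma).1 l hl
    have h0 := (L.exists_out hl).2 ⟨b, ea⟩
    obtain ⟨b', eb⟩ := (L'.exists_out (u := a') hl).1 (by omega)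
    exact ⟨b', eb, ma.step hl ea eb⟩
  have commute : ∀ {y}, E j y x → E i y z →
      (Far i j ∨ Neighb i j ∧ (h i x = h i y ∨ h j z = h j y)) →
      ∃ z', E' j z' u' ∧ Match N E E' s s' d z z' := by
    intro y yx yz hc
    obtain ⟨d', y', rfl, ey, my⟩ := (ih d le_rfl x x' m).2.2.2.1 j hj y yx
    obtain ⟨z', ez', mz⟩ := down (by omega) my hi yz
    refine ⟨z', ?_, mz⟩
    have sx := (ih _ le_rfl x x' m).1
    have sz := (ih _ le_rfl z z' mz).1
    have sy := (ih d' (by omega) y y' my).1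
    have : ∃ w, E' i x' w ∧ E' j z' w := by
      rcases hc with hf | ⟨hn, hc | hc⟩
      · obtain ⟨w, p, q⟩ := L'.far_down hi hj hf ez' ey
        exact ⟨w, q, p⟩
      · have := L'.near_down hj hi hn.symm ey ez' (by rw [← (sx i hi).1, ← (sy i hi).1, hc])
        exact this.2
      · obtain ⟨w, p, q⟩ := (L'.near_down hi hj hn ez' ey
          (by rw [← (sz j hj).1, ← (sy j hj).1, hc])).2
        exact ⟨w, q, p⟩
    obtain ⟨w, p, q⟩ := this
    obtain rfl := L'.out_unique hi e' p
    exact q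
  rcases eq_or_neighb_or_far i j with rfl | hn | hf
  · obtain rfl := L.in_unique hi e ez
    exact ⟨x', e', m⟩
  · have sx := L.same hi e
    have sz := L.same hj ez
    rcases L.near hi hj hn e with ⟨h1, -⟩ | ⟨h1, -⟩
    · obtain ⟨h2, y, p, q⟩ := L.near_up hi hj hn e ez h1
      have := L.same hi q
      exact commute p q (Or.inr ⟨hn, Or.inl (by omega)⟩)
    · rcases L.near hj hi hn.symm ez with ⟨h2, -⟩ | ⟨h2, -⟩
      · obtain ⟨h3, y, p, q⟩ := L.near_up hj hi hn.symm ez e h2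
        have := L.same hj q
        exact commute q p (Or.inr ⟨hn, Or.inr (by omega)⟩)
      · obtain ⟨p, q, p', q', w, a, b, c, a', b', c'⟩ := L.verma_up hi hj hn e ez h1 h2
        have l1 := L.verma_up_label hi hj hn e ez h1 h2 a b c a' b' c'
        have l2 := L.verma_up_label hj hi hn.symm ez e h2 h1 a' b' c' a b c
        obtain ⟨d1, P, rfl, eP, mP⟩ := (ih d le_rfl x x' m).2.2.2.1 j hj p a
        obtain ⟨d2, Q, rfl, eQ, mQ⟩ := (ih d1 (by omega) p P mP).2.2.2.1 j hj q b
        obtain ⟨d3, w', rfl, ew, mw⟩ := (ih d2 (by omega) q Q mQ).2.2.2.1 i hi w c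
        obtain ⟨Q', eQ', mQ'⟩ := down (by omega) mw hj c'
        obtain ⟨P', eP', mP'⟩ := down (by omega) mQ' hi b'
        obtain ⟨z', ez', mz⟩ := down (by omega) mP' hi a'
        refine ⟨z', ?_, mz⟩
        have sw := (ih d3 (by omega) w w' mw).1
        have sq := (ih _ (by omega) q Q mQ).1
        have sq' := (ih _ (by omega) q' Q' mQ').1
        obtain ⟨r1, r2, r1', r2', r, f1, f2, f3, f1', f2', f3'⟩ := L'.verma_down hi hj hn ew eQ'
          (by rw [← (sq j hj).1, ← (sw j hj).1, l1]) (by rw [← (sq' i hi).1, ← (sw i hi).1, l2])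
        obtain rfl := L'.out_unique hj eQ f1
        obtain rfl := L'.out_unique hj eP f2
        obtain rfl := L'.out_unique hi e' f3
        obtain rfl := L'.out_unique hi eP' f1'
        obtain rfl := L'.out_unique hi ez' f2'
        exact f3'
  · obtain ⟨y, p, q⟩ := L.far_up hi hj hf e ez
    exact commute p q (Or.inl hf)

theorem match_strings (L : LocalCrystal N E h t) (L' : LocalCrystal N E' h' t')
    {d : ℕ} (ih : ∀ k ≤ d, GoodMatch N E E' h t h' t' s s' k)
    {i : ℕ} {x u : V} {x' u' : W} (m : Match N E E' s s' d x x') (hi : i ∈ Set.Icc 1 N)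
    (e : E i x u) (e' : E' i x' u') : SameStrings N h t h' t' u u' := by
  intro j hj
  have sx := (ih d le_rfl x x' m).1 j hj
  rcases eq_or_neighb_or_far i j with rfl | hn | hf
  · have := L.same hi e
    have := L'.same hi e'
    omega
  · have ht : t j u = t' j u' := by
      by_cases h1 : 0 < t j u
      · obtain ⟨z, ez⟩ := (L.exists_in hj).1 h1
        obtain ⟨z', ez', mz⟩ := match_lift L L' ih m hi e e' hj ez
        have := L.same hj ez
        have := L'.same hj ez'
        have := (ih d le_rfl z z' mz).1 j hj
        omega
      · by_cases h2 : 0 < t' j u'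
        · obtain ⟨z', ez'⟩ := (L'.exists_in hj).1 h2
          obtain ⟨z, ez, mz⟩ := match_lift L' L (fun k hk => (ih k hk).swap) m.swap hi e' e hj ez'
          exact absurd ((L.exists_in hj).2 ⟨z, ez⟩) h1
        · have := L.t_nonneg u hj
          have := L'.t_nonneg u' hj
          omega
    have h1 := L.near hi hj hn e
    have h2 := L'.near hi hj hn e'
    omega
  · have := L.far hi hj hf e
    have := L'.far hi hj hf e'
    omega

theorem match_unique (L : LocalCrystal N E h t) (L' : LocalCrystal N E' h' t')
    {d : ℕ} (ih : ∀ k ≤ d, GoodMatch N E E' h t h' t' s s' k)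
    {i : ℕ} {x u : V} {x' u' : W} (m : Match N E E' s s' d x x') (hi : i ∈ Set.Icc 1 N)
    (e : E i x u) (e' : E' i x' u') {w' : W} (mw : Match N E E' s s' (d + 1) u w') :
    w' = u' := by
  cases mw with
  | step mz hj ez ez' =>
    obtain ⟨z', ez'', mz'⟩ := match_lift L L' ih m hi e e' hj ez
    have := (ih d le_rfl _ _ mz').2.1 _ mz
    subst this
    exact L'.out_unique hj ez' ez''

/-- Two regular crystals with the same parameters match: the matching is a
string-preserving partial bijection. -/
theorem goodMatch (L : LocalCrystal N E h t) (L' : LocalCrystal N E' h' t')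
    (hs : IsHighest N t s) (hs' : IsHighest N t' s') (hh : ∀ i ∈ Set.Icc 1 N, h i s = h' i s')
    (d : ℕ) :
    GoodMatch N E E' h t h' t' s s' d := by
  induction d using Nat.strong_induction_on with
  | _ d ih =>
    intro u u' m
    cases m with
    | base =>
      refine ⟨fun i hi => ⟨hh i hi, by rw [hs i hi, hs' i hi]⟩, ?_, ?_, ?_, ?_⟩
      · intro w' mw; cases mw; rfl
      · intro w mw; cases mw; rfl
      · intro i hi z e; exact absurd e (LocalCrystal.no_in_of_highest L hs hi)
      · intro i hi z e; exact absurd e (LocalCrystal.no_in_of_highest L' hs' hi)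
    | @step d i x x' _ _ m hi e e' =>
      have ih' : ∀ k ≤ d, GoodMatch N E E' h t h' t' s s' k := fun k hk => ih k (by omega)
      have ih'' : ∀ k ≤ d, GoodMatch N E' E h' t' h t s' s k := fun k hk => (ih' k hk).swap
      refine ⟨match_strings L L' ih' m hi e e', fun w' mw => match_unique L L' ih' m hi e e' mw,
        fun w mw => match_unique L' L ih'' m.swap hi e' e mw.swap, ?_, ?_⟩
      · intro j hj z ez
        obtain ⟨z', ez', mz⟩ := match_lift L L' ih' m hi e e' hj ez
        exact ⟨d, z', rfl, ez', mz⟩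
      · intro j hj z ez
        obtain ⟨z', ez', mz⟩ := match_lift L' L ih'' m.swap hi e' e hj ez
        exact ⟨d, z', rfl, ez', mz.swap⟩

theorem match_functional (L : LocalCrystal N E h t) (L' : LocalCrystal N E' h' t')
    (hs : IsHighest N t s) (hs' : IsHighest N t' s') (hh : ∀ i ∈ Set.Icc 1 N, h i s = h' i s')
    {d k : ℕ} {u : V} {u' w' : W} (m : Match N E E' s s' d u u')
    (m' : Match N E E' s s' k u w') : w' = u' := by
  have h1 := m.rank_eq L
  have h2 := m'.rank_eq L
  obtain rfl : d = k := by omega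
  exact (goodMatch L L' hs hs' hh d u u' m).2.1 w' m'

theorem match_step (L : LocalCrystal N E h t) (L' : LocalCrystal N E' h' t')
    (hs : IsHighest N t s) (hs' : IsHighest N t' s') (hh : ∀ i ∈ Set.Icc 1 N, h i s = h' i s')
    {d i : ℕ} {u v : V} {u' : W} (m : Match N E E' s s' d u u') (hi : i ∈ Set.Icc 1 N)
    (e : E i u v) : ∃ v', E' i u' v' ∧ Match N E E' s s' (d + 1) v v' := by
  have h1 := (goodMatch L L' hs hs' hh d u u' m).1 i hi
  have h2 := (L.exists_out hi).2 ⟨v, e⟩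
  obtain ⟨v', e'⟩ := (L'.exists_out (u := u') hi).1 (by omega)
  exact ⟨v', e', m.step hi e e'⟩

end

/-! ### A polyhedral model of the `A_3`-crystals with parameter `(p, q, p)` -/

/-- Coordinates of the polyhedral model with respect to the color word `1 3 2 1 3 2`. -/
@[ext] structure Pt where
  a₁ : ℤ
  a₃ : ℤ
  b : ℤ
  d₁ : ℤ
  d₃ : ℤ
  e : ℤ

/-- The polytope of the model with parameter `(p, q, p)`. -/
structure Pt.OK (p q : ℤ) (x : Pt) : Prop where
  a₁_nonneg : 0 ≤ x.a₁
  a₁_le : x.a₁ ≤ p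
  a₃_nonneg : 0 ≤ x.a₃
  a₃_le : x.a₃ ≤ p
  b_le : x.b ≤ q + x.a₁ + x.a₃
  d₃_le : x.d₃ ≤ q + x.a₁
  d₁_le : x.d₁ ≤ q + x.a₃
  d₁_le_b : x.d₁ ≤ x.b
  d₃_le_b : x.d₃ ≤ x.b
  d_le : x.d₁ + x.d₃ ≤ x.b + q
  e_nonneg : 0 ≤ x.e
  e_le_d₁ : x.e ≤ x.d₁
  e_le_d₃ : x.e ≤ x.d₃
  e_le : x.e ≤ q

/-- Outgoing string lengths. -/
def Pt.h (p q : ℤ) : ℕ → Pt → ℤ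
  | 1, x => max (p - x.a₁) (p - 2 * x.a₁ - x.d₁ + x.b)
  | 2, x => max (q - x.b + x.a₁ + x.a₃) (q - 2 * x.b - x.e + x.a₁ + x.a₃ + x.d₁ + x.d₃)
  | 3, x => max (p - x.a₃) (p - 2 * x.a₃ - x.d₃ + x.b)
  | _, _ => 0

/-- Incoming string lengths. -/
def Pt.t : ℕ → Pt → ℤ
  | 1, x => max (x.a₁ - x.b + 2 * x.d₁ - x.e) (x.d₁ - x.e)
  | 2, x => max (x.b - x.d₁ - x.d₃ + 2 * x.e) x.e
  | 3, x => max (x.a₃ - x.b + 2 * x.d₃ - x.e) (x.d₃ - x.e)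
  | _, _ => 0

/-- Lowering operators. -/
def Pt.f : ℕ → Pt → Pt
  | 1, x => if x.b ≤ x.a₁ + x.d₁ then { x with a₁ := x.a₁ + 1 } else { x with d₁ := x.d₁ + 1 }
  | 2, x => if x.d₁ + x.d₃ ≤ x.b + x.e then { x with b := x.b + 1 } else { x with e := x.e + 1 }
  | 3, x => if x.b ≤ x.a₃ + x.d₃ then { x with a₃ := x.a₃ + 1 } else { x with d₃ := x.d₃ + 1 }
  | _, x => x

/-- Raising operators. -/
def Pt.g : ℕ → Pt → Pt
  | 1, x => if x.b < x.a₁ + x.d₁ then { x with a₁ := x.a₁ - 1 } else { x with d₁ := x.d₁ - 1 }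
  | 2, x => if x.d₁ + x.d₃ < x.b + x.e then { x with b := x.b - 1 } else { x with e := x.e - 1 }
  | 3, x => if x.b < x.a₃ + x.d₃ then { x with a₃ := x.a₃ - 1 } else { x with d₃ := x.d₃ - 1 }
  | _, x => x

/-- Vertices of the model. -/
def Model (p q : ℤ) : Type := {x : Pt // x.OK p q}

/-- Edges of the model. -/
def Model.E (p q : ℤ) (i : ℕ) (u v : Model p q) : Prop := 0 < u.1.h p q i ∧ v.1 = u.1.f i

theorem mem_Icc_three {i : ℕ} (hi : i ∈ Set.Icc 1 3) : i = 1 ∨ i = 2 ∨ i = 3 := by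
  have := hi.1
  have := hi.2
  omega

namespace Pt

variable {p q : ℤ} {x : Pt}

theorem ok_f {i : ℕ} (hi : i ∈ Set.Icc 1 3) (hx : x.OK p q) (h0 : 0 < x.h p q i) :
    (x.f i).OK p q := by
  obtain ⟨a₁, a₃, b, d₁, d₃, e⟩ := x
  obtain ⟨_, _, _, _, _, _, _, _, _, _, _, _, _, _⟩ := hx
  rcases mem_Icc_three hi with rfl | rfl | rfl <;> simp only [h, f] at * <;> split_ifs <;>
    constructor <;> dsimp only <;> omega

theorem ok_g {i : ℕ} (hi : i ∈ Set.Icc 1 3) (hx : x.OK p q) (h0 : 0 < x.t i) :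
    (x.g i).OK p q := by
  obtain ⟨a₁, a₃, b, d₁, d₃, e⟩ := x
  obtain ⟨_, _, _, _, _, _, _, _, _, _, _, _, _, _⟩ := hx
  rcases mem_Icc_three hi with rfl | rfl | rfl <;> simp only [t, g] at * <;> split_ifs <;>
    constructor <;> dsimp only <;> omega

theorem f_g {i : ℕ} (hi : i ∈ Set.Icc 1 3) : (x.g i).f i = x := by
  obtain ⟨a₁, a₃, b, d₁, d₃, e⟩ := x
  rcases mem_Icc_three hi with rfl | rfl | rfl <;> simp only [f, g] <;> split_ifs <;>
    simp only [Pt.mk.injEq, true_and, and_true] at * <;> omega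

theorem g_f {i : ℕ} (hi : i ∈ Set.Icc 1 3) : (x.f i).g i = x := by
  obtain ⟨a₁, a₃, b, d₁, d₃, e⟩ := x
  rcases mem_Icc_three hi with rfl | rfl | rfl <;> simp only [f, g] <;> split_ifs <;>
    simp only [Pt.mk.injEq, true_and, and_true] at * <;> omega

theorem strings_f {i : ℕ} (hi : i ∈ Set.Icc 1 3) :
    (x.f i).h p q i = x.h p q i - 1 ∧ (x.f i).t i = x.t i + 1 := by
  obtain ⟨a₁, a₃, b, d₁, d₃, e⟩ := x
  rcases mem_Icc_three hi with rfl | rfl | rfl <;> simp only [f, h, t] <;> split_ifs <;>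
    dsimp only <;> omega

theorem h_nonneg {i : ℕ} (hi : i ∈ Set.Icc 1 3) (hx : x.OK p q) : 0 ≤ x.h p q i := by
  obtain ⟨_, _, _, _, _, _, _, _, _, _, _, _, _, _⟩ := hx
  rcases mem_Icc_three hi with rfl | rfl | rfl <;> simp only [h] <;> omega

theorem t_nonneg {i : ℕ} (hi : i ∈ Set.Icc 1 3) (hx : x.OK p q) : 0 ≤ x.t i := by
  obtain ⟨_, _, _, _, _, _, _, _, _, _, _, _, _, _⟩ := hx
  rcases mem_Icc_three hi with rfl | rfl | rfl <;> simp only [t] <;> omega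

theorem strings_far {i j : ℕ} (hi : i ∈ Set.Icc 1 3) (hj : j ∈ Set.Icc 1 3) (hij : Far i j) :
    (x.f i).h p q j = x.h p q j ∧ (x.f i).t j = x.t j := by
  obtain ⟨a₁, a₃, b, d₁, d₃, e⟩ := x
  unfold Far at hij
  rcases mem_Icc_three hi with rfl | rfl | rfl <;> rcases mem_Icc_three hj with rfl | rfl | rfl <;>
    first | omega | (simp only [f, h, t]; split_ifs <;> simp)

theorem f_comm_far {i j : ℕ} (hi : i ∈ Set.Icc 1 3) (hj : j ∈ Set.Icc 1 3) (hij : Far i j) :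
    (x.f i).f j = (x.f j).f i := by
  obtain ⟨a₁, a₃, b, d₁, d₃, e⟩ := x
  unfold Far at hij
  rcases mem_Icc_three hi with rfl | rfl | rfl <;> rcases mem_Icc_three hj with rfl | rfl | rfl <;>
    first | omega | (simp only [f]; split_ifs <;> rfl)

theorem g_comm_far {i j : ℕ} (hi : i ∈ Set.Icc 1 3) (hj : j ∈ Set.Icc 1 3) (hij : Far i j) :
    (x.g i).g j = (x.g j).g i := by
  obtain ⟨a₁, a₃, b, d₁, d₃, e⟩ := x
  unfold Far at hij
  rcases mem_Icc_three hi with rfl | rfl | rfl <;> rcases mem_Icc_three hj with rfl | rfl | rfl <;>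
    first | omega | (simp only [g]; split_ifs <;> rfl)

end Pt

namespace Pt

variable {p q : ℤ} {x : Pt}

theorem strings_near {i j : ℕ} (hi : i ∈ Set.Icc 1 3) (hj : j ∈ Set.Icc 1 3) (hij : Neighb i j) :
    ((x.f i).h p q j = x.h p q j + 1 ∧ (x.f i).t j = x.t j) ∨
      ((x.f i).h p q j = x.h p q j ∧ (x.f i).t j = x.t j - 1) := by
  obtain ⟨a₁, a₃, b, d₁, d₃, e⟩ := x
  unfold Neighb at hij
  rcases mem_Icc_three hi with rfl | rfl | rfl <;> rcases mem_Icc_three hj with rfl | rfl | rfl <;>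
    first | omega | (simp only [f, h, t]; split_ifs <;> dsimp only <;> omega)

theorem f_comm_near {i j : ℕ} (hi : i ∈ Set.Icc 1 3) (hj : j ∈ Set.Icc 1 3) (hij : Neighb i j)
    (hl : (x.f i).h p q j = x.h p q j) :
    (x.f j).h p q i = x.h p q i + 1 ∧ (x.f i).f j = (x.f j).f i := by
  obtain ⟨a₁, a₃, b, d₁, d₃, e⟩ := x
  unfold Neighb at hij
  rcases mem_Icc_three hi with rfl | rfl | rfl <;> rcases mem_Icc_three hj with rfl | rfl | rfl <;>
    first
    | omega
    | (simp only [f, h] at *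
       split_ifs at * <;> dsimp only at * <;>
         simp only [Pt.mk.injEq, true_and, and_true] <;> omega)

theorem g_comm_near {i j : ℕ} (hi : i ∈ Set.Icc 1 3) (hj : j ∈ Set.Icc 1 3) (hij : Neighb i j)
    (hl : x.h p q j = (x.g i).h p q j + 1) :
    x.h p q i = (x.g j).h p q i ∧ (x.g i).g j = (x.g j).g i := by
  obtain ⟨a₁, a₃, b, d₁, d₃, e⟩ := x
  unfold Neighb at hij
  rcases mem_Icc_three hi with rfl | rfl | rfl <;> rcases mem_Icc_three hj with rfl | rfl | rfl <;>
    first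
    | omega
    | (simp only [g, h] at *
       split_ifs at * <;> dsimp only at * <;>
         simp only [Pt.mk.injEq, true_and, and_true] <;> omega)

end Pt

namespace Pt

variable {p q : ℤ} {x : Pt}

theorem f_verma {i j : ℕ} (hi : i ∈ Set.Icc 1 3) (hj : j ∈ Set.Icc 1 3) (hij : Neighb i j)
    (hl : (x.f i).h p q j = x.h p q j + 1) (hl' : (x.f j).h p q i = x.h p q i + 1) :
    (((x.f i).f j).f j).h p q i = x.h p q i ∧
    (((x.f i).f j).f j).f i = (((x.f j).f i).f i).f j := by
  obtain ⟨a₁, a₃, b, d₁, d₃, e⟩ := x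
  unfold Neighb at hij
  rcases mem_Icc_three hi with rfl | rfl | rfl <;> rcases mem_Icc_three hj with rfl | rfl | rfl <;>
    first
    | omega
    | (simp only [f, h] at hl hl'
       split_ifs at hl hl' <;> dsimp only at hl hl' <;> first
         | omega
         | (simp (disch := omega) only [f, h, if_pos, if_neg]
            simp only [and_true]
            omega))

theorem g_verma {i j : ℕ} (hi : i ∈ Set.Icc 1 3) (hj : j ∈ Set.Icc 1 3) (hij : Neighb i j)
    (hl : x.h p q j = (x.g i).h p q j) (hl' : x.h p q i = (x.g j).h p q i) :
    (((x.g i).g j).g j).t i = x.t i ∧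
    (((x.g i).g j).g j).g i = (((x.g j).g i).g i).g j := by
  obtain ⟨a₁, a₃, b, d₁, d₃, e⟩ := x
  unfold Neighb at hij
  rcases mem_Icc_three hi with rfl | rfl | rfl <;> rcases mem_Icc_three hj with rfl | rfl | rfl <;>
    first
    | omega
    | (simp only [g, h] at hl hl'
       split_ifs at hl hl' <;> dsimp only at hl hl' <;> first
         | omega
         | (simp (disch := omega) only [g, t, if_pos, if_neg]
            simp only [and_true]
            omega))

end Pt

namespace Model

variable {p q : ℤ}

theorem edge_iff {i : ℕ} (hi : i ∈ Set.Icc 1 3) {u v : Model p q} :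
    Model.E p q i u v ↔ 0 < v.1.t i ∧ u.1 = v.1.g i := by
  constructor
  · rintro ⟨h0, hv⟩
    have h1 := (Pt.strings_f (p := p) (q := q) (x := u.1) hi).2
    have h2 := Pt.t_nonneg hi u.2
    rw [hv, Pt.g_f hi]
    exact ⟨by omega, rfl⟩
  · rintro ⟨h0, hu⟩
    have h1 := (Pt.strings_f (p := p) (q := q) (x := u.1) hi).1
    have h2 := Pt.h_nonneg hi v.2
    have h3 : u.1.f i = v.1 := by rw [hu, Pt.f_g hi]
    rw [h3] at h1
    exact ⟨by omega, h3.symm⟩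

theorem edge_f {i : ℕ} (hi : i ∈ Set.Icc 1 3) (u : Model p q) (h0 : 0 < u.1.h p q i) :
    Model.E p q i u ⟨u.1.f i, Pt.ok_f hi u.2 h0⟩ := ⟨h0, rfl⟩

theorem edge_g {i : ℕ} (hi : i ∈ Set.Icc 1 3) (u : Model p q) (h0 : 0 < u.1.t i) :
    Model.E p q i ⟨u.1.g i, Pt.ok_g hi u.2 h0⟩ u := (edge_iff hi).2 ⟨h0, rfl⟩

/-- The model satisfies the local axioms. -/
theorem localCrystal (p q : ℤ) :
    LocalCrystal 3 (Model.E p q) (fun i u => u.1.h p q i) (fun i u => u.1.t i) where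
  out_unique := fun _ e e' => Subtype.ext (e.2.trans e'.2.symm)
  in_unique := fun hi e e' =>
    Subtype.ext (((edge_iff hi).1 e).2.trans ((edge_iff hi).1 e').2.symm)
  t_nonneg := fun u hi => Pt.t_nonneg hi u.2
  exists_out := fun hi => ⟨fun h0 => ⟨_, edge_f hi _ h0⟩, fun ⟨_, e⟩ => e.1⟩
  exists_in := fun hi => ⟨fun h0 => ⟨_, edge_g hi _ h0⟩, fun ⟨_, e⟩ => ((edge_iff hi).1 e).1⟩
  same := fun hi e => by simp only [e.2]; exact Pt.strings_f hi
  far := fun hi hj hij e => by simp only [e.2]; exact Pt.strings_far hi hj hij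
  near := fun hi hj hij e => by simp only [e.2]; exact Pt.strings_near hi hj hij
  far_down := by
    intro i j u v v' hi hj hij e e'
    have h1 := (Pt.strings_far (p := p) (q := q) (x := u.1) hi hj hij).1
    have h2 := (Pt.strings_far (p := p) (q := q) (x := u.1) hj hi hij.symm).1
    rw [← e.2] at h1
    rw [← e'.2] at h2
    refine ⟨_, edge_f hj v (h1 ▸ e'.1), h2 ▸ e.1, ?_⟩
    change v.1.f j = v'.1.f i
    rw [e.2, e'.2, Pt.f_comm_far hi hj hij]
  far_up := by
    intro i j u u' v hi hj hij e e'
    have e1 := (edge_iff hi).1 e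
    have e1' := (edge_iff hj).1 e'
    have h1 := (Pt.strings_far (p := p) (q := q) (x := u.1) hi hj hij).2
    have h2 := (Pt.strings_far (p := p) (q := q) (x := u'.1) hj hi hij.symm).2
    rw [← e.2] at h1
    rw [← e'.2] at h2
    refine ⟨_, edge_g hj u (h1 ▸ e1'.1), (edge_iff hi).2 ⟨h2 ▸ e1.1, ?_⟩⟩
    change u.1.g j = u'.1.g i
    rw [e1.2, e1'.2, Pt.g_comm_far hi hj hij]
  near_down := by
    intro i j u v v' hi hj hij e e' hl
    have h1 := Pt.f_comm_near (p := p) (q := q) (x := u.1) hi hj hij (by rw [← e.2]; exact hl)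
    rw [← e.2, ← e'.2] at h1
    have := e.1
    refine ⟨h1.1, _, edge_f hj v (hl.symm ▸ e'.1), by omega, ?_⟩
    exact h1.2
  near_up := by
    intro i j u u' v hi hj hij e e' hl
    have e1 := (edge_iff hi).1 e
    have e1' := (edge_iff hj).1 e'
    have h1 := Pt.g_comm_near (p := p) (q := q) (x := v.1) hi hj hij (by rw [← e1.2]; exact hl)
    rw [← e1.2, ← e1'.2] at h1
    have h3 := Pt.strings_near (p := p) (q := q) (x := u.1) hi hj hij
    have h4 := Pt.strings_near (p := p) (q := q) (x := u'.1) hj hi hij.symm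
    rw [← e.2] at h3
    rw [← e'.2] at h4
    refine ⟨h1.1, _, edge_g hj u (by omega), (edge_iff hi).2 ⟨by omega, ?_⟩⟩
    exact h1.2
  verma_down := by
    intro i j u v v' hi hj hij e e' hl hl'
    have := e.1
    have := e'.1
    have key := Pt.f_verma (p := p) (q := q) (x := u.1) hi hj hij
      (by rw [← e.2]; exact hl) (by rw [← e'.2]; exact hl')
    have key' := Pt.f_verma (p := p) (q := q) (x := u.1) hj hi hij.symm
      (by rw [← e'.2]; exact hl') (by rw [← e.2]; exact hl)
    rw [← e.2, ← e'.2] at key key'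
    have s1 := (Pt.strings_f (p := p) (q := q) (x := v.1) hj).1
    have s2 := (Pt.strings_f (p := p) (q := q) (x := v'.1) hi).1
    have e1 := edge_f hj v (by omega)
    have e2 := edge_f hj ⟨v.1.f j, Pt.ok_f hj v.2 e1.1⟩ (show 0 < (v.1.f j).h p q j by omega)
    have e3 := edge_f hi ⟨(v.1.f j).f j, Pt.ok_f hj (Pt.ok_f hj v.2 e1.1) e2.1⟩
      (show 0 < ((v.1.f j).f j).h p q i by omega)
    have e1' := edge_f hi v' (by omega)
    have e2' := edge_f hi ⟨v'.1.f i, Pt.ok_f hi v'.2 e1'.1⟩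
      (show 0 < (v'.1.f i).h p q i by omega)
    refine ⟨_, _, _, _, _, e1, e2, e3, e1', e2', ?_, key.2⟩
    change 0 < ((v'.1.f i).f i).h p q j
    omega
  verma_up := by
    intro i j u u' v hi hj hij e e' hl hl'
    have a := (edge_iff hi).1 e
    have a' := (edge_iff hj).1 e'
    have h3 := Pt.strings_near (p := p) (q := q) (x := u.1) hi hj hij
    have h4 := Pt.strings_near (p := p) (q := q) (x := u'.1) hj hi hij.symm
    rw [← e.2] at h3
    rw [← e'.2] at h4
    have key := Pt.g_verma (p := p) (q := q) (x := v.1) hi hj hij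
      (by rw [← a.2]; exact hl) (by rw [← a'.2]; exact hl')
    have key' := Pt.g_verma (p := p) (q := q) (x := v.1) hj hi hij.symm
      (by rw [← a'.2]; exact hl') (by rw [← a.2]; exact hl)
    rw [← a.2, ← a'.2] at key key'
    have s1 := (Pt.strings_f (p := p) (q := q) (x := u.1.g j) hj).2
    have s2 := (Pt.strings_f (p := p) (q := q) (x := u'.1.g i) hi).2
    rw [Pt.f_g hj] at s1
    rw [Pt.f_g hi] at s2
    have p1 : 0 < u.1.t j := by omega
    have p2 : 0 < (u.1.g j).t j := by omega
    have p3 : 0 < ((u.1.g j).g j).t i := by omega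
    have p1' : 0 < u'.1.t i := by omega
    have p2' : 0 < (u'.1.g i).t i := by omega
    have e2 := edge_g hj ⟨u.1.g j, Pt.ok_g hj u.2 p1⟩ p2
    have e3 := edge_g hi ⟨(u.1.g j).g j, Pt.ok_g hj (Pt.ok_g hj u.2 p1) p2⟩ p3
    have e2' := edge_g hi ⟨u'.1.g i, Pt.ok_g hi u'.2 p1'⟩ p2'
    refine ⟨_, _, _, _, _, edge_g hj u p1, e2, e3, edge_g hi u' p1', e2',
      (edge_iff hj).2 ⟨?_, key.2⟩⟩
    change 0 < ((u'.1.g i).g i).t j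
    omega

end Model

/-! ### Worms as points of the polyhedral model -/

/-- The point of the polyhedral model associated to a worm. -/
def wormPt : ℤ × ℤ × ℤ × ℤ × ℤ × ℤ → Pt
  | (x', y, x'', y', x, y'') => ⟨x'' / 2, x'' / 2, x + y'', x' / 2 + y, x' / 2 + y, y'⟩

/-- The sum of the entries of a worm. -/
def wormSum : ℤ × ℤ × ℤ × ℤ × ℤ × ℤ → ℤ
  | (x', y, x'', y', x, y'') => x' + y + x'' + y' + x + y''

section Worm

variable {g1 g2 : ℕ} {w w' : ℤ × ℤ × ℤ × ℤ × ℤ × ℤ}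

theorem wormPt_ok (hw : WormOK g1 g2 w) : (wormPt w).OK g1 g2 := by
  obtain ⟨x', y, x'', y', x, y''⟩ := w
  simp only [WormOK] at hw
  constructor <;> simp only [wormPt] <;> omega

theorem wormPt_injective (hw : WormOK g1 g2 w) (hw' : WormOK g1 g2 w')
    (hp : wormPt w = wormPt w') : w = w' := by
  obtain ⟨x', y, x'', y', x, y''⟩ := w
  obtain ⟨z', u, z'', u', z, u''⟩ := w'
  simp only [WormOK, wormPt, Pt.mk.injEq, Prod.mk.injEq] at *
  omega

theorem worm2_ok_iff (hw : WormOK g1 g2 w) :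
    WormOK g1 g2 (worm2 w) ↔ 0 < (wormPt w).h g1 g2 2 := by
  obtain ⟨x', y, x'', y', x, y''⟩ := w
  simp only [WormOK] at hw
  simp only [worm2]
  split_ifs <;> simp only [WormOK, wormPt, Pt.h] <;> omega

theorem wormPt_worm2 (hw : WormOK g1 g2 w) : wormPt (worm2 w) = (wormPt w).f 2 := by
  obtain ⟨x', y, x'', y', x, y''⟩ := w
  simp only [WormOK] at hw
  simp only [worm2, wormPt, Pt.f]
  split_ifs <;> simp only [Pt.mk.injEq, true_and, and_true] <;> omega

theorem worm1_ok_iff (hw : WormOK g1 g2 w) :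
    WormOK g1 g2 (worm1 w) ↔ 0 < (wormPt w).h g1 g2 1 := by
  obtain ⟨x', y, x'', y', x, y''⟩ := w
  simp only [WormOK] at hw
  simp only [worm1]
  split_ifs <;> simp only [WormOK, wormPt, Pt.h] <;> omega

theorem wormPt_h_three : (wormPt w).h g1 g2 3 = (wormPt w).h g1 g2 1 := rfl

theorem wormPt_worm1 (hw : WormOK g1 g2 w) : wormPt (worm1 w) = ((wormPt w).f 1).f 3 := by
  obtain ⟨x', y, x'', y', x, y''⟩ := w
  simp only [WormOK] at hw
  simp only [worm1, wormPt, Pt.f]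
  split_ifs <;> simp only [Pt.mk.injEq, true_and, and_true] <;> omega

theorem wormSum_worm1 : wormSum w < wormSum (worm1 w) := by
  obtain ⟨x', y, x'', y', x, y''⟩ := w
  simp only [worm1]
  split_ifs <;> simp only [wormSum] <;> omega

theorem wormSum_worm2 : wormSum w < wormSum (worm2 w) := by
  obtain ⟨x', y, x'', y', x, y''⟩ := w
  simp only [worm2]
  split_ifs <;> simp only [wormSum] <;> omega

theorem wormSum_nonneg (hw : WormOK g1 g2 w) : 0 ≤ wormSum w := by
  obtain ⟨x', y, x'', y', x, y''⟩ := w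
  simp only [WormOK] at hw
  simp only [wormSum]
  omega

theorem wormOK_zero : WormOK g1 g2 0 := by
  change WormOK g1 g2 (0, 0, 0, 0, 0, 0)
  simp only [WormOK]
  omega

/-- Every worm other than the zero worm has a predecessor. -/
theorem worm_pred (hw : WormOK g1 g2 w) (h0 : w ≠ 0) :
    ∃ u, WormOK g1 g2 u ∧ (worm1 u = w ∨ worm2 u = w) := by
  obtain ⟨x', y, x'', y', x, y''⟩ := w
  have h0' : ¬ (x' = 0 ∧ y = 0 ∧ x'' = 0 ∧ y' = 0 ∧ x = 0 ∧ y'' = 0) := by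
    rintro ⟨rfl, rfl, rfl, rfl, rfl, rfl⟩
    exact h0 rfl
  simp only [WormOK] at hw
  by_cases c1 : 2 * x < x' + x''
  · refine ⟨(x', y, x'' - 2, y', x, y''), ?_, Or.inl ?_⟩
    · simp only [WormOK]; omega
    · simp only [worm1]; split_ifs <;> simp only [Prod.mk.injEq, true_and, and_true] <;> omega
  by_cases c2 : x = x' ∧ x = x'' ∧ y' < y
  · refine ⟨(x', y - 1, x'', y', x, y''), ?_, Or.inl ?_⟩
    · simp only [WormOK]; omega
    · simp only [worm1]; split_ifs <;> simp only [Prod.mk.injEq, true_and, and_true] <;> omega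
  by_cases c3 : 2 * y < y' + y''
  · refine ⟨(x', y, x'', y', x, y'' - 1), ?_, Or.inr ?_⟩
    · simp only [WormOK]; omega
    · simp only [worm2]; split_ifs <;> simp only [Prod.mk.injEq, true_and] <;> omega
  by_cases c4 : y = y' ∧ y = y'' ∧ x' < x
  · refine ⟨(x', y, x'', y', x - 1, y''), ?_, Or.inr ?_⟩
    · simp only [WormOK]; omega
    · simp only [worm2]; split_ifs <;> simp only [Prod.mk.injEq, true_and, and_true] <;> omega
  by_cases c5 : 0 < x' ∧ y' = y
  · refine ⟨(x' - 2, y, x'', y', x, y''), ?_, Or.inl ?_⟩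
    · simp only [WormOK]; omega
    · simp only [worm1]; split_ifs <;> simp only [Prod.mk.injEq, true_and, and_true] <;> omega
  · refine ⟨(x', y, x'', y' - 1, x, y''), ?_, Or.inr ?_⟩
    · simp only [WormOK]; omega
    · simp only [worm2]; split_ifs <;> simp only [Prod.mk.injEq, true_and, and_true] <;> omega

end Worm

/-! ### String lengths of colored graphs -/

section OptIter

variable {V : Type} {f : V → Option V}

theorem optIter_add (m k : ℕ) (u : V) :
    optIter f (m + k) u = (optIter f m u).bind (optIter f k) := by
  induction m generalizing u with
  | zero => simp [optIter]
  | succ m ih =>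
    rw [Nat.succ_add]
    simp only [optIter]
    cases f u with
    | none => rfl
    | some a => exact ih a

theorem optIter_grade {T : V → ℕ} (hT : ∀ u v, f u = some v → T v = T u + 1) {k : ℕ} {u v : V}
    (e : optIter f k u = some v) : T v = T u + k := by
  induction k generalizing u with
  | zero => simp only [optIter, Option.some.injEq] at e; subst e; rfl
  | succ k ih =>
    simp only [optIter] at e
    obtain ⟨a, ha, hk⟩ := Option.bind_eq_some_iff.1 e
    have := hT _ _ ha
    have := ih hk
    omega

theorem optIter_no_cycle_of_grade {T : V → ℕ} (hT : ∀ u v, f u = some v → T v = T u + 1) {k : ℕ}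
    (hk : 0 < k) (v : V) : optIter f k v ≠ some v := by
  intro e
  have := optIter_grade hT e
  omega

end OptIter

namespace PreGraph

theorem finv_eq_some {K : PreGraph} {i : ℕ}
    (inj : ∀ u u' v, K.F i u = some v → K.F i u' = some v → u = u') {u v : K.V} :
    K.Finv i v = some u ↔ K.F i u = some v := by
  unfold Finv
  constructor
  · intro e
    split_ifs at e with hx
    have := hx.choose_spec
    rwa [Option.some.inj e] at this
  · intro e
    have hx : ∃ u, K.F i u = some v := ⟨u, e⟩
    rw [dif_pos hx, inj _ _ _ hx.choose_spec e]

end PreGraph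

namespace IsColored

variable {K : PreGraph} {C : Set ℕ}

theorem inj (hK : IsColored K C) {i : ℕ} {u u' v : K.V} (e : K.F i u = some v)
    (e' : K.F i u' = some v) : u = u' := hK.2.2.1 i u u' v e e'

theorem bddAbove_out (hK : IsColored K C) (i : ℕ) (v : K.V) :
    BddAbove {k | (optIter (K.F i) k v).isSome = true} := by
  have := hK.1
  apply Set.Finite.bddAbove
  refine Set.Finite.of_finite_image (f := fun k => optIter (K.F i) k v) (Set.toFinite _) ?_
  intro a ha b hb hab
  wlog hlt : a ≤ b generalizing a b
  · exact (this hb ha hab.symm (by omega)).symm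
  obtain ⟨x, hx⟩ := Option.isSome_iff_exists.1 ha
  have hb' : optIter (K.F i) b v = some x := hab.symm.trans hx
  obtain ⟨c, rfl⟩ := Nat.exists_eq_add_of_le hlt
  rw [optIter_add, hx, Option.bind_some] at hb'
  rcases Nat.eq_zero_or_pos c with rfl | hc
  · rfl
  · exact absurd hb' (hK.2.2.2 i x c hc)

theorem bddAbove_in (hK : IsColored K C) (i : ℕ) (v : K.V) :
    BddAbove {k | ∃ u, optIter (K.F i) k u = some v} := by
  have := hK.1
  apply Set.Finite.bddAbove
  refine Set.Finite.of_finite_image (f := fun k =>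
    if hx : ∃ u, optIter (K.F i) k u = some v then hx.choose else v) (Set.toFinite _) ?_
  intro a ha b hb hab
  wlog hlt : a ≤ b generalizing a b
  · exact (this hb ha hab.symm (by omega)).symm
  simp only [Set.mem_ofPred_eq] at ha hb
  simp only [dif_pos ha, dif_pos hb] at hab
  have h1 := ha.choose_spec
  have h2 := hb.choose_spec
  rw [← hab] at h2
  obtain ⟨c, rfl⟩ := Nat.exists_eq_add_of_le hlt
  rw [optIter_add, h1, Option.bind_some] at h2
  rcases Nat.eq_zero_or_pos c with rfl | hc
  · rfl
  · exact absurd h2 (hK.2.2.2 i v c hc)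

theorem h_eq_zero (K : PreGraph) {i : ℕ} {u : K.V} (e : K.F i u = none) : K.h i u = 0 := by
  have : {k | (optIter (K.F i) k u).isSome = true} = {0} := by
    ext k
    cases k <;> simp [optIter, e]
  simp [PreGraph.h, this]

theorem h_succ (hK : IsColored K C) {i : ℕ} {u v : K.V} (e : K.F i u = some v) :
    K.h i u = K.h i v + 1 := by
  have key : ∀ k, (optIter (K.F i) (k + 1) u).isSome = true ↔
      (optIter (K.F i) k v).isSome = true := by
    intro k
    simp [optIter, e]
  apply le_antisymm
  · refine csSup_le ⟨0, by simp [optIter]⟩ ?_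
    rintro (_ | k) hk
    · omega
    · have := le_csSup (hK.bddAbove_out i v) ((key k).1 hk)
      exact Nat.succ_le_succ this
  · refine le_csSup (hK.bddAbove_out i u) ((key _).2 ?_)
    exact Nat.sSup_mem (s := {k | (optIter (K.F i) k v).isSome = true}) ⟨0, by simp [optIter]⟩
      (hK.bddAbove_out i v)

theorem t_eq_zero (K : PreGraph) {i : ℕ} {v : K.V} (e : ∀ u, K.F i u ≠ some v) : K.t i v = 0 := by
  have : {k | ∃ u, optIter (K.F i) k u = some v} = {0} := by
    ext k
    rcases k with _ | k
    · simp [optIter]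
    · simp only [Set.mem_ofPred_eq, Set.mem_singleton_iff, Nat.succ_ne_zero, iff_false]
      rintro ⟨u, hu⟩
      rw [optIter_add] at hu
      obtain ⟨a, -, ha⟩ := Option.bind_eq_some_iff.1 hu
      exact e a (by simpa [optIter] using ha)
  simp [PreGraph.t, this]

theorem t_succ (hK : IsColored K C) {i : ℕ} {u v : K.V} (e : K.F i u = some v) :
    K.t i v = K.t i u + 1 := by
  have key : ∀ k x, optIter (K.F i) (k + 1) x = some v ↔ optIter (K.F i) k x = some u := by
    intro k x
    rw [optIter_add, Option.bind_eq_some_iff]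
    constructor
    · rintro ⟨a, ha, hk⟩
      rwa [hK.inj (show K.F i a = some v by simpa [optIter] using hk) e] at ha
    · intro hk
      exact ⟨u, hk, by simp [optIter, e]⟩
  apply le_antisymm
  · refine csSup_le ⟨0, v, by simp [optIter]⟩ ?_
    rintro (_ | k) ⟨x, hk⟩
    · omega
    · have := le_csSup (hK.bddAbove_in i u) ⟨x, (key k x).1 hk⟩
      exact Nat.succ_le_succ this
  · refine le_csSup (hK.bddAbove_in i v) ?_
    obtain ⟨x, hx⟩ := Nat.sSup_mem (s := {k | ∃ x, optIter (K.F i) k x = some u})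
      ⟨0, u, by simp [optIter]⟩ (hK.bddAbove_in i u)
    exact ⟨x, (key _ x).2 hx⟩

theorem h_pos_iff (hK : IsColored K C) {i : ℕ} {u : K.V} :
    0 < K.h i u ↔ ∃ v, K.F i u = some v := by
  rcases e : K.F i u with _ | v
  · simp [h_eq_zero K e]
  · simp [hK.h_succ e]

theorem t_pos_iff (hK : IsColored K C) {i : ℕ} {v : K.V} :
    0 < K.t i v ↔ ∃ u, K.F i u = some v := by
  by_cases e : ∃ u, K.F i u = some v
  · obtain ⟨u, e⟩ := e
    exact ⟨fun _ => ⟨u, e⟩, fun _ => by simp [hK.t_succ e]⟩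
  · have := t_eq_zero K (i := i) (v := v) (fun u hu => e ⟨u, hu⟩)
    exact ⟨fun hp => by omega, fun hx => absurd hx e⟩

/-- The recursion characterizing outgoing string lengths. -/
theorem h_unique (hK : IsColored K C) {i : ℕ} {H : K.V → ℕ}
    (hs : ∀ u v, K.F i u = some v → H u = H v + 1) (hz : ∀ u, K.F i u = none → H u = 0)
    (u : K.V) : K.h i u = H u := by
  induction m : K.h i u generalizing u with
  | zero =>
    rcases e : K.F i u with _ | v
    · exact (hz u e).symm
    · have := hK.h_succ e
      omega
  | succ k ih =>
    obtain ⟨v, e⟩ := hK.h_pos_iff.1 (show 0 < K.h i u by omega)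
    have h1 := hK.h_succ e
    rw [hs u v e, ← ih v (by omega)]

/-- The recursion characterizing incoming string lengths. -/
theorem t_unique (hK : IsColored K C) {i : ℕ} {T : K.V → ℕ}
    (hs : ∀ u v, K.F i u = some v → T v = T u + 1)
    (hz : ∀ v, (∀ u, K.F i u ≠ some v) → T v = 0) (v : K.V) : K.t i v = T v := by
  induction m : K.t i v generalizing v with
  | zero =>
    refine (hz v fun u e => ?_).symm
    have := hK.t_succ e
    omega
  | succ k ih =>
    obtain ⟨u, e⟩ := hK.t_pos_iff.1 (show 0 < K.t i v by omega)
    have h1 := hK.t_succ e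
    rw [hs u v e, ← ih u (by omega)]

end IsColored

/-- The partial relations `P` and `Q` commute, in the sense of (A5) with all choices of
directions. -/
structure Comm {V : Type} (P Q : V → V → Prop) : Prop where
  down : ∀ {u v v'}, P u v → Q u v' → ∃ w, Q v w ∧ P v' w
  up : ∀ {u u' v}, P u v → Q u' v → ∃ w, Q w u ∧ P w u'
  mixed : ∀ {u v v'}, P u v → Q v v' → ∃ w, Q u w ∧ P w v'
  mixed' : ∀ {u v v'}, Q u v → P v v' → ∃ w, P u w ∧ Q w v'

section

variable {K : PreGraph} {i j : ℕ}

theorem A5at.comm (inj : ∀ (k : ℕ) (u u' v : K.V), K.F k u = some v → K.F k u' = some v → u = u')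
    (h5 : A5at K i j) :
    Comm (fun u v => K.F i u = some v) (fun u v => K.F j u = some v) where
  down := by
    intro u v v' e e'
    obtain ⟨w, h1, h2⟩ := h5 (K.F i) (by simp) (K.F j) (by simp) u (by simp [e]) (by simp [e'])
    rw [e, Option.bind_some] at h1
    rw [e', Option.bind_some] at h2
    exact ⟨w, h1, h2⟩
  up := by
    intro u u' v e e'
    rw [← PreGraph.finv_eq_some (inj _)] at e e'
    obtain ⟨w, h1, h2⟩ := h5 (K.Finv i) (by simp) (K.Finv j) (by simp) v (by simp [e])
      (by simp [e'])
    rw [e, Option.bind_some, PreGraph.finv_eq_some (inj _)] at h1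
    rw [e', Option.bind_some, PreGraph.finv_eq_some (inj _)] at h2
    exact ⟨w, h1, h2⟩
  mixed := by
    intro u v v' e e'
    rw [← PreGraph.finv_eq_some (inj _)] at e
    obtain ⟨w, h1, h2⟩ := h5 (K.Finv i) (by simp) (K.F j) (by simp) v (by simp [e])
      (by simp [e'])
    rw [e, Option.bind_some] at h1
    rw [e', Option.bind_some, PreGraph.finv_eq_some (inj _)] at h2
    exact ⟨w, h1, h2⟩
  mixed' := by
    intro u v v' e e'
    rw [← PreGraph.finv_eq_some (inj _)] at e
    obtain ⟨w, h1, h2⟩ := h5 (K.F i) (by simp) (K.Finv j) (by simp) v (by simp [e'])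
      (by simp [e])
    rw [e', Option.bind_some, PreGraph.finv_eq_some (inj _)] at h1
    rw [e, Option.bind_some] at h2
    exact ⟨w, h2, h1⟩

theorem A5at.of_comm (inj : ∀ (k : ℕ) (u u' v : K.V), K.F k u = some v → K.F k u' = some v → u = u')
    (hc : Comm (fun u v => K.F i u = some v) (fun u v => K.F j u = some v)) : A5at K i j := by
  intro Fi hi Fj hj v hv hv'
  obtain ⟨a, ha⟩ := Option.isSome_iff_exists.1 hv
  obtain ⟨b, hb⟩ := Option.isSome_iff_exists.1 hv'
  simp only [Set.mem_insert_iff, Set.mem_singleton_iff] at hi hj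
  rw [ha, hb, Option.bind_some, Option.bind_some]
  rcases hi with rfl | rfl <;> rcases hj with rfl | rfl
  · exact hc.down ha hb
  · rw [PreGraph.finv_eq_some (inj _)] at hb
    obtain ⟨w, h1, h2⟩ := hc.mixed' hb ha
    exact ⟨w, (PreGraph.finv_eq_some (inj _)).2 h2, h1⟩
  · rw [PreGraph.finv_eq_some (inj _)] at ha
    obtain ⟨w, h1, h2⟩ := hc.mixed ha hb
    exact ⟨w, h1, (PreGraph.finv_eq_some (inj _)).2 h2⟩
  · rw [PreGraph.finv_eq_some (inj _)] at ha hb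
    obtain ⟨w, h1, h2⟩ := hc.up ha hb
    exact ⟨w, (PreGraph.finv_eq_some (inj _)).2 h1, (PreGraph.finv_eq_some (inj _)).2 h2⟩

end

theorem IsACrystal.comm {M : ℕ} {K : PreGraph} (hK : IsACrystal M K) {i j : ℕ}
    (hi : i ∈ Set.Icc 1 M) (hj : j ∈ Set.Icc 1 M) (hij : Far i j) :
    Comm (fun u v => K.F i u = some v) (fun u v => K.F j u = some v) :=
  (hK.2.2.2.2 i hi j hj hij).comm hK.1.2.2.1

/-- A window of consecutive colors of an `A_M`-crystal satisfies the local axioms. -/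
theorem IsACrystal.localCrystal {M : ℕ} {K : PreGraph} (hK : IsACrystal M K) {o N : ℕ}
    (ho : o + N ≤ M) : LocalCrystal N (fun i u v => K.F (o + i) u = some v)
      (fun i u => (K.h (o + i) u : ℤ)) (fun i u => (K.t (o + i) u : ℤ)) := by
  have mem : ∀ {i}, i ∈ Set.Icc 1 N → o + i ∈ Set.Icc 1 M := by
    intro i hi
    have h1 := hi.1
    have h2 := hi.2
    constructor <;> omega
  have nb : ∀ {i j}, Neighb i j → Neighb (o + i) (o + j) := by
    intro i j hij
    unfold Neighb at *
    omega
  have fr : ∀ {i j}, Far i j → Far (o + i) (o + j) := by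
    intro i j hij
    unfold Far at *
    omega
  have inj := hK.1.2.2.1
  have finv : ∀ {i u v}, K.Finv i v = some u ↔ K.F i u = some v :=
    fun {i} => PreGraph.finv_eq_some (inj i)
  refine
    { out_unique := fun _ e e' => Option.some.inj (e.symm.trans e')
      in_unique := fun _ e e' => hK.1.inj e e'
      t_nonneg := fun _ _ => Int.natCast_nonneg _
      exists_out := fun _ => by rw [Int.natCast_pos]; exact hK.1.h_pos_iff
      exists_in := fun _ => by rw [Int.natCast_pos]; exact hK.1.t_pos_iff
      same := ?_, far := ?_, near := ?_
      far_down := fun hi hj hij e e' => (hK.comm (mem hi) (mem hj) (fr hij)).down e e'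
      far_up := fun hi hj hij e e' => (hK.comm (mem hi) (mem hj) (fr hij)).up e e'
      near_down := ?_, near_up := ?_, verma_down := ?_, verma_up := ?_ }
  · intro i u v _ e
    have h1 := hK.1.h_succ e
    have h2 := hK.1.t_succ e
    constructor <;> omega
  · intro i j u v hi hj hij e
    have hne : o + i ≠ o + j := by unfold Far at hij; omega
    have hnn : ¬ Neighb (o + i) (o + j) := by unfold Far at hij; unfold Neighb; omega
    have := (hK.2.2.1 _ (mem hi) _ (mem hj) hne).1 u v e
    rw [if_neg hnn] at this
    omega
  · intro i j u v hi hj hij e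
    have hne : o + i ≠ o + j := by unfold Neighb at hij; omega
    have := (hK.2.2.1 _ (mem hi) _ (mem hj) hne).1 u v e
    rw [if_pos (nb hij)] at this
    omega
  · intro i j u v v' hi hj hij e e' hl
    have := (hK.2.2.2.1 _ (mem hi) _ (mem hj) (nb hij)).1.1 u v v' e e' (by omega)
    exact ⟨by omega, this.2⟩
  · intro i j u u' v hi hj hij e e' hl
    have := (hK.2.2.2.1 _ (mem hi) _ (mem hj) (nb hij)).1.2 u u' v e e' (by omega)
    exact ⟨by omega, this.2⟩
  · intro i j u v v' hi hj hij e e' hl hl'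
    obtain ⟨w, h1, h2⟩ := (hK.2.2.2.1 _ (mem hi) _ (mem hj) (nb hij)).2.1 u v v' e e'
      (by omega) (by omega)
    rw [e, Option.bind_some] at h1
    rw [e', Option.bind_some] at h2
    obtain ⟨y, hy, hw⟩ := Option.bind_eq_some_iff.1 h1
    obtain ⟨x, hx, hy⟩ := Option.bind_eq_some_iff.1 hy
    obtain ⟨y', hy', hw'⟩ := Option.bind_eq_some_iff.1 h2
    obtain ⟨x', hx', hy'⟩ := Option.bind_eq_some_iff.1 hy'
    exact ⟨x, y, x', y', w, hx, hy, hw, hx', hy', hw'⟩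
  · intro i j u u' v hi hj hij e e' hl hl'
    obtain ⟨w, h1, h2⟩ := (hK.2.2.2.1 _ (mem hi) _ (mem hj) (nb hij)).2.2 u u' v e e'
      (by omega) (by omega)
    rw [finv.2 e, Option.bind_some] at h1
    rw [finv.2 e', Option.bind_some] at h2
    obtain ⟨y, hy, hw⟩ := Option.bind_eq_some_iff.1 h1
    obtain ⟨x, hx, hy⟩ := Option.bind_eq_some_iff.1 hy
    obtain ⟨y', hy', hw'⟩ := Option.bind_eq_some_iff.1 h2
    obtain ⟨x', hx', hy'⟩ := Option.bind_eq_some_iff.1 hy'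
    exact ⟨x, y, x', y', w, finv.1 hx, finv.1 hy, finv.1 hw, finv.1 hx', finv.1 hy', finv.1 hw'⟩

/-! ### The symmetric extract -/

theorem exists_source_reach {V : Type} {D : V → V → Prop} (wf : WellFounded D) (v : V) :
    ∃ s, (∀ u, ¬ D u s) ∧ Relation.ReflTransGen D s v := by
  induction v using wf.induction with
  | _ v ih =>
    by_cases hv : ∃ u, D u v
    · obtain ⟨u, hu⟩ := hv
      obtain ⟨s, h1, h2⟩ := ih u hu
      exact ⟨s, h1, h2.tail hu⟩
    · exact ⟨v, fun u hu => hv ⟨u, hu⟩, .refl⟩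

theorem wellFounded_of_rank {V : Type} [Finite V] {D : V → V → Prop} (R : V → ℤ)
    (hR : ∀ a b, D a b → R b < R a) : WellFounded D := by
  have : IsTrans V (fun a b => R b < R a) := ⟨fun _ _ _ h1 h2 => h2.trans h1⟩
  have : Std.Irrefl (fun a b : V => R b < R a) := ⟨fun _ h => lt_irrefl _ h⟩
  exact Subrelation.wf (r := fun a b => R b < R a) (fun h => hR _ _ h)
    (Finite.wellFounded_of_trans_of_irrefl _)

/-- A symmetric `A_{2n-1}`-crystal with its complementarity map. -/
structure SymCrystal (n : ℕ) (K : PreGraph) (σ : K.V → K.V) : Prop where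
  two_le : 2 ≤ n
  crystal : IsACrystal (2 * n - 1) K
  bij : Function.Bijective σ
  edge : ∀ (i : ℕ) (u v : K.V), K.F i u = some v ↔ K.F (2 * n - i) (σ u) = some (σ v)

namespace SymCrystal

variable {n : ℕ} {K : PreGraph} {σ : K.V → K.V}

theorem localCrystal (H : SymCrystal n K σ) :
    LocalCrystal (2 * n - 1) (fun i u v => K.F i u = some v)
      (fun i u => (K.h i u : ℤ)) (fun i u => (K.t i u : ℤ)) := by
  have := H.crystal.localCrystal (o := 0) (N := 2 * n - 1) (by omega)
  simpa only [Nat.zero_add] using this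

theorem finite (H : SymCrystal n K σ) : Finite K.V := H.crystal.1.1

theorem color_mem (H : SymCrystal n K σ) {i : ℕ} {u v : K.V} (e : K.F i u = some v) :
    i ∈ Set.Icc 1 (2 * n - 1) := by
  by_contra hi
  rw [H.crystal.1.2.1 i hi u] at e
  cases e

theorem edge' (H : SymCrystal n K σ) {i : ℕ} (hi : i ∈ Set.Icc 1 (2 * n - 1)) {u v : K.V}
    (e : K.F (2 * n - i) u = some v) : K.F i (σ u) = some (σ v) := by
  have := (H.edge (2 * n - i) u v).1 e
  rwa [Nat.sub_sub_self (by have := hi.2; omega)] at this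

theorem edge_of_fixed (H : SymCrystal n K σ) {i : ℕ} {u v : K.V} (hu : σ u = u)
    (e : K.F i u = some v) : K.F (2 * n - i) u = some (σ v) := by
  have := (H.edge i u v).1 e
  rwa [hu] at this

theorem edge_to_fixed (H : SymCrystal n K σ) {i : ℕ} {u v : K.V} (hv : σ v = v)
    (e : K.F i u = some v) : K.F (2 * n - i) (σ u) = some v := by
  have := (H.edge i u v).1 e
  rwa [hv] at this

theorem source_iff {s : K.V} (H : SymCrystal n K σ) :
    IsSource K s ↔ IsHighest (2 * n - 1) (fun i u => (K.t i u : ℤ)) s := by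
  constructor
  · intro hs i _
    have := IsColored.t_eq_zero K (hs i)
    simp only [this, Nat.cast_zero]
  · intro hs i u e
    have h1 : (K.t i s : ℤ) = 0 := hs i (H.color_mem e)
    have h2 := H.crystal.1.t_succ e
    omega

theorem source_unique (H : SymCrystal n K σ) {s s' : K.V} (hs : IsSource K s)
    (hs' : IsSource K s') : s = s' := by
  have := H.finite
  refine H.localCrystal.top_unique (u := s) (v := s') ?_ (H.source_iff.1 hs) (H.source_iff.1 hs')
    .refl .refl
  refine Relation.ReflTransGen.mono ?_ _ _ (H.crystal.2.1 s s')
  rintro a b ⟨i, e | e⟩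
  · exact ⟨i, H.color_mem e, Or.inl e⟩
  · exact ⟨i, H.color_mem e, Or.inr e⟩

theorem source_fixed (H : SymCrystal n K σ) {s : K.V} (hs : IsSource K s) : σ s = s := by
  refine (H.source_unique hs ?_).symm
  intro i u e
  obtain ⟨u, rfl⟩ := H.bij.2 u
  have hi := H.color_mem e
  have hi' : 2 * n - i ∈ Set.Icc 1 (2 * n - 1) := by
    have h1 := hi.1
    have h2 := hi.2
    constructor <;> omega
  refine hs (2 * n - i) u ((H.edge _ _ _).2 ?_)
  rwa [Nat.sub_sub_self (by have := hi.2; omega)]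

theorem h_compl (H : SymCrystal n K σ) (i : ℕ) (v : K.V) :
    K.h (2 * n - i) (σ v) = K.h i v := by
  symm
  refine H.crystal.1.h_unique (H := fun v => K.h (2 * n - i) (σ v)) ?_ ?_ v
  · intro u w e
    exact H.crystal.1.h_succ ((H.edge i u w).1 e)
  · intro u e
    apply IsColored.h_eq_zero K
    by_contra hne
    obtain ⟨w, hw⟩ := Option.ne_none_iff_exists'.1 hne
    obtain ⟨w, rfl⟩ := H.bij.2 w
    rw [(H.edge i u w).2 hw] at e
    cases e

variable {u w : (extractB K n σ).V} {i : ℕ}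

theorem extract_edge_iff :
    (extractB K n σ).F i u = some w ↔ chainB K n i u.1 = some w.1 := by
  change (chainB K n i u.1).pbind _ = some w ↔ _
  refine Option.pbind_eq_some_iff.trans ?_
  constructor
  · rintro ⟨b, hb, e⟩
    split_ifs at e with hσ
    rw [← Option.some.inj e]
    exact hb
  · intro e
    exact ⟨w.1, e, dif_pos w.2⟩

theorem extract_edge_lt (h1 : 1 ≤ i) (h2 : i < n) :
    (extractB K n σ).F i u = some w ↔
      ∃ m, K.F i u.1 = some m ∧ K.F (2 * n - i) m = some w.1 := by
  rw [extract_edge_iff, chainB, if_pos ⟨h1, h2.le⟩, if_neg h2.ne, Option.bind_eq_some_iff]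

theorem extract_edge_self (hn : 1 ≤ n) :
    (extractB K n σ).F n u = some w ↔ K.F n u.1 = some w.1 := by
  rw [extract_edge_iff, chainB, if_pos ⟨hn, le_rfl⟩, if_pos rfl]

theorem extract_color_mem (e : (extractB K n σ).F i u = some w) : i ∈ Set.Icc 1 n := by
  rw [extract_edge_iff, chainB] at e
  split_ifs at e with hi
  · exact ⟨hi.1, hi.2⟩
  · exact ⟨hi.1, hi.2⟩

theorem mem_of_mem (hi : i ∈ Set.Icc 1 n) : i ∈ Set.Icc 1 (2 * n - 1) := by
  have h1 := hi.1
  have h2 := hi.2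
  constructor <;> omega

theorem compl_mem (hi : i ∈ Set.Icc 1 n) : 2 * n - i ∈ Set.Icc 1 (2 * n - 1) := by
  have h1 := hi.1
  have h2 := hi.2
  constructor <;> omega

theorem far_compl {j : ℕ} (hij : i + j + 2 ≤ 2 * n) :
    Far i (2 * n - j) := by
  unfold Far
  omega

theorem extract_exists_out (H : SymCrystal n K σ) (hi : i ∈ Set.Icc 1 n) {m : K.V}
    (e : K.F i u.1 = some m) : ∃ w, (extractB K n σ).F i u = some w := by
  rcases hi.2.eq_or_lt with rfl | hlt
  · have e' := H.edge_of_fixed u.2 e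
    rw [show 2 * i - i = i by omega, e] at e'
    exact ⟨⟨m, (Option.some.inj e').symm⟩, (extract_edge_self hi.1).2 e⟩
  · have e' := H.edge_of_fixed u.2 e
    obtain ⟨z, hz, hz'⟩ := H.localCrystal.far_down (mem_of_mem hi) (compl_mem hi)
      (far_compl (by omega)) e e'
    have := H.edge' (mem_of_mem hi) hz
    rw [hz'] at this
    exact ⟨⟨z, (Option.some.inj this).symm⟩, (extract_edge_lt hi.1 hlt).2 ⟨m, e, hz⟩⟩

theorem extract_exists_in (H : SymCrystal n K σ) (hi : i ∈ Set.Icc 1 n) {m : K.V}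
    (e : K.F i m = some u.1) : ∃ w, (extractB K n σ).F i w = some u := by
  rcases hi.2.eq_or_lt with rfl | hlt
  · have e' := H.edge_to_fixed u.2 e
    rw [show 2 * i - i = i by omega] at e'
    exact ⟨⟨m, H.crystal.1.inj e' e⟩, (extract_edge_self hi.1).2 e⟩
  · have e' := H.edge_to_fixed u.2 e
    obtain ⟨z, hz, hz'⟩ := H.localCrystal.far_up (mem_of_mem hi) (compl_mem hi)
      (far_compl (by omega)) e e'
    have h1 := H.edge' (mem_of_mem hi) hz
    have h2 := H.crystal.1.inj h1 hz'
    refine ⟨⟨z, h2⟩, (extract_edge_lt hi.1 hlt).2 ⟨σ m, hz', e'⟩⟩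

/-- An edge of the extract decreases the rank. -/
theorem extract_rank (H : SymCrystal n K σ) (e : (extractB K n σ).F i u = some w) :
    crystalRank (2 * n - 1) (fun i u => (K.h i u : ℤ)) (fun i u => (K.t i u : ℤ)) w.1 <
      crystalRank (2 * n - 1) (fun i u => (K.h i u : ℤ)) (fun i u => (K.t i u : ℤ)) u.1 := by
  have hi := extract_color_mem e
  rcases hi.2.eq_or_lt with rfl | hlt
  · have := H.localCrystal.rank_edge (mem_of_mem hi) ((extract_edge_self hi.1).1 e)
    omega
  · obtain ⟨m, h1, h2⟩ := (extract_edge_lt hi.1 hlt).1 e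
    have h3 := H.localCrystal.rank_edge (mem_of_mem hi) h1
    have h4 := H.localCrystal.rank_edge (compl_mem hi) h2
    omega

theorem extract_same (H : SymCrystal n K σ) (e : (extractB K n σ).F i u = some w) :
    K.h i u.1 = K.h i w.1 + 1 ∧ K.t i w.1 = K.t i u.1 + 1 := by
  have hi := extract_color_mem e
  rcases hi.2.eq_or_lt with rfl | hlt
  · have e' := (extract_edge_self hi.1).1 e
    exact ⟨H.crystal.1.h_succ e', H.crystal.1.t_succ e'⟩
  · obtain ⟨m, h1, h2⟩ := (extract_edge_lt hi.1 hlt).1 e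
    have h3 := H.crystal.1.h_succ h1
    have h4 := H.crystal.1.t_succ h1
    have h5 := H.localCrystal.far (compl_mem hi) (mem_of_mem hi)
      (far_compl (by omega)).symm h2
    omega

theorem extract_isColored (H : SymCrystal n K σ) :
    IsColored (extractB K n σ) (Set.Icc 1 n) := by
  have := H.finite
  refine ⟨Subtype.finite, ?_, ?_, ?_⟩
  · intro i hi v
    by_contra hne
    obtain ⟨w, hw⟩ := Option.ne_none_iff_exists'.1 hne
    exact hi (extract_color_mem hw)
  · intro i u u' v e e'
    have hi := extract_color_mem e
    rcases hi.2.eq_or_lt with rfl | hlt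
    · rw [extract_edge_self hi.1] at e e'
      exact Subtype.ext (H.crystal.1.inj e e')
    · rw [extract_edge_lt hi.1 hlt] at e e'
      obtain ⟨m, h1, h2⟩ := e
      obtain ⟨m', h1', h2'⟩ := e'
      have := H.crystal.1.inj h2 h2'
      subst this
      exact Subtype.ext (H.crystal.1.inj h1 h1')
  · intro i v k hk
    exact optIter_no_cycle_of_grade (T := fun v => K.t i v.1) (fun u v e => (H.extract_same e).2)
      hk v

theorem extract_h (H : SymCrystal n K σ) (hi : i ∈ Set.Icc 1 n) (u : (extractB K n σ).V) :
    (extractB K n σ).h i u = K.h i u.1 := by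
  refine H.extract_isColored.h_unique (H := fun u => K.h i u.1)
    (fun u v e => (H.extract_same e).1) ?_ u
  intro u e
  by_contra hne
  obtain ⟨m, hm⟩ := H.crystal.1.h_pos_iff.1 (Nat.pos_of_ne_zero hne)
  obtain ⟨w, hw⟩ := H.extract_exists_out hi hm
  rw [hw] at e
  cases e

theorem extract_t (H : SymCrystal n K σ) (hi : i ∈ Set.Icc 1 n) (u : (extractB K n σ).V) :
    (extractB K n σ).t i u = K.t i u.1 := by
  refine H.extract_isColored.t_unique (T := fun u => K.t i u.1)
    (fun u v e => (H.extract_same e).2) ?_ u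
  intro u e
  by_contra hne
  obtain ⟨m, hm⟩ := H.crystal.1.t_pos_iff.1 (Nat.pos_of_ne_zero hne)
  obtain ⟨w, hw⟩ := H.extract_exists_in hi hm
  exact e w hw

/-- A vertex of the extract without incoming edges is the source of `K`. -/
theorem source_of_extract (H : SymCrystal n K σ)
    (hu : ∀ j v, (extractB K n σ).F j v ≠ some u) : IsSource K u.1 := by
  intro i m e
  have hi := H.color_mem e
  have h1 := hi.1
  have h2 := hi.2
  rcases le_total i n with hle | hle
  · obtain ⟨w, hw⟩ := H.extract_exists_in ⟨h1, hle⟩ e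
    exact hu _ _ hw
  · obtain ⟨w, hw⟩ := H.extract_exists_in (i := 2 * n - i) (u := u) ⟨by omega, by omega⟩
      (H.edge_to_fixed u.2 e)
    exact hu _ _ hw

theorem extract_connected (H : SymCrystal n K σ) {s : K.V} (hs : IsSource K s) :
    (extractB K n σ).Connected := by
  have := H.finite
  have : Finite (extractB K n σ).V := Subtype.finite
  have down : ∀ v, Relation.ReflTransGen
      (fun a b => ∃ i, (extractB K n σ).F i a = some b) ⟨s, H.source_fixed hs⟩ v := by
    intro v
    obtain ⟨s', h1, h2⟩ := exists_source_reach (wellFounded_of_rank _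
      (fun a b (e : ∃ i, (extractB K n σ).F i a = some b) => H.extract_rank e.choose_spec)) v
    have h3 := H.source_of_extract (u := s') fun j v e => h1 v ⟨j, e⟩
    rwa [show (⟨s, H.source_fixed hs⟩ : (extractB K n σ).V) = s' from
      Subtype.ext (H.source_unique hs h3)]
  have up : ∀ v, Relation.ReflTransGen (extractB K n σ).Step ⟨s, H.source_fixed hs⟩ v :=
    fun v => Relation.ReflTransGen.mono (fun a b ⟨i, e⟩ => ⟨i, Or.inl e⟩) _ _ (down v)
  have : Std.Symm (extractB K n σ).Step := ⟨fun a b ⟨i, e⟩ => ⟨i, e.symm⟩⟩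
  exact fun u v => (symm (up u)).trans (up v)

end SymCrystal

/-! ### Commuting relations and words -/

namespace Comm

variable {V : Type} {P P' Q : V → V → Prop}

theorem symm (c : Comm P Q) : Comm Q P where
  down e e' := (c.down e' e).imp fun _ h => h.symm
  up e e' := (c.up e' e).imp fun _ h => h.symm
  mixed := c.mixed'
  mixed' := c.mixed

theorem eq_left : Comm (fun u v => u = v) Q where
  down := fun e e' => ⟨_, e ▸ e', rfl⟩
  up := fun e e' => ⟨_, e ▸ e', rfl⟩
  mixed := fun e e' => ⟨_, e ▸ e', rfl⟩
  mixed' := fun e e' => ⟨_, rfl, e' ▸ e⟩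

theorem comp (c : Comm P Q) (c' : Comm P' Q) : Comm (Relation.Comp P P') Q where
  down := by
    rintro u v v' ⟨m, e1, e2⟩ e'
    obtain ⟨a, h1, h2⟩ := c.down e1 e'
    obtain ⟨b, h3, h4⟩ := c'.down e2 h1
    exact ⟨b, h3, a, h2, h4⟩
  up := by
    rintro u u' v ⟨m, e1, e2⟩ e'
    obtain ⟨a, h1, h2⟩ := c'.up e2 e'
    obtain ⟨b, h3, h4⟩ := c.up e1 h1
    exact ⟨b, h3, a, h4, h2⟩
  mixed := by
    rintro u v v' ⟨m, e1, e2⟩ e'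
    obtain ⟨a, h1, h2⟩ := c'.mixed e2 e'
    obtain ⟨b, h3, h4⟩ := c.mixed e1 h1
    exact ⟨b, h3, a, h4, h2⟩
  mixed' := by
    rintro u v v' e' ⟨m, e1, e2⟩
    obtain ⟨a, h1, h2⟩ := c.mixed' e' e1
    obtain ⟨b, h3, h4⟩ := c'.mixed' h2 e2
    exact ⟨b, ⟨a, h1, h3⟩, h4⟩

end Comm

/-- Directed paths spelling a given word of colors. -/
def wordPath {V : Type} (E : ℕ → V → V → Prop) : List ℕ → V → V → Prop
  | [] => fun u v => u = v
  | a :: L => Relation.Comp (E a) (wordPath E L)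

section Word

variable {V : Type} {E E' : ℕ → V → V → Prop}

theorem wordPath_comm {L : List ℕ} {Q : V → V → Prop} (c : ∀ a ∈ L, Comm (E a) Q) :
    Comm (wordPath E L) Q := by
  induction L with
  | nil => exact Comm.eq_left
  | cons a L ih =>
    exact (c a (by simp)).comp (ih fun b hb => c b (by simp [hb]))

theorem wordPath_comm₂ {L L' : List ℕ} (c : ∀ a ∈ L, ∀ b ∈ L', Comm (E a) (E' b)) :
    Comm (wordPath E L) (wordPath E' L') :=
  wordPath_comm fun a ha => (wordPath_comm fun b hb => (c a ha b hb).symm).symm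

theorem wordPath_comp {L : List ℕ} (c : ∀ a ∈ L, ∀ b ∈ L, Comm (E a) (E' b)) {u x w : V}
    (p : wordPath E L u x) (p' : wordPath E' L x w) :
    wordPath (fun a => Relation.Comp (E a) (E' a)) L u w := by
  induction L generalizing u x with
  | nil => exact Eq.trans p p'
  | cons a L ih =>
    obtain ⟨y, h1, h2⟩ := p
    obtain ⟨z, h3, h4⟩ := p'
    have cc : Comm (wordPath E L) (E' a) :=
      wordPath_comm fun b hb => c b (by simp [hb]) a (by simp)
    obtain ⟨y', h5, h6⟩ := cc.mixed h2 h3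
    exact ⟨y', ⟨y, h1, h5⟩, ih (fun b hb b' hb' => c b (by simp [hb]) b' (by simp [hb'])) h6 h4⟩

theorem wordPath_functional (hE : ∀ a u v v', E a u v → E a u v' → v = v') {L : List ℕ} {u v v' : V}
    (p : wordPath E L u v) (p' : wordPath E L u v') : v = v' := by
  induction L generalizing u with
  | nil => exact Eq.trans (Eq.symm p) p'
  | cons a L ih =>
    obtain ⟨y, h1, h2⟩ := p
    obtain ⟨z, h3, h4⟩ := p'
    obtain rfl := hE _ _ _ _ h1 h3
    exact ih h2 h4

theorem wordPath_injective (hE : ∀ a u u' v, E a u v → E a u' v → u = u') {L : List ℕ} {u u' v : V}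
    (p : wordPath E L u v) (p' : wordPath E L u' v) : u = u' := by
  induction L generalizing u u' with
  | nil => exact Eq.trans p (Eq.symm p')
  | cons a L ih =>
    obtain ⟨y, h1, h2⟩ := p
    obtain ⟨z, h3, h4⟩ := p'
    obtain rfl := ih h2 h4
    exact hE _ _ _ _ h1 h3

theorem wordPath_map {W : Type} {E' : ℕ → W → W → Prop} {f : V → W}
    (hf : ∀ a u v, E a u v → E' a (f u) (f v)) {L : List ℕ} {u v : V} (p : wordPath E L u v) :
    wordPath E' L (f u) (f v) := by
  induction L generalizing u with
  | nil => exact congrArg f p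
  | cons a L ih =>
    obtain ⟨y, h1, h2⟩ := p
    exact ⟨f y, hf _ _ _ h1, ih h2⟩

end Word

namespace SymCrystal

variable {n : ℕ} {K : PreGraph} {σ : K.V → K.V} {u w : (extractB K n σ).V} {i j : ℕ}

theorem chain_lt (h1 : 1 ≤ i) (h2 : i < n) {u w : K.V} : chainB K n i u = some w ↔
    Relation.Comp (fun u v => K.F i u = some v) (fun u v => K.F (2 * n - i) u = some v) u w := by
  rw [chainB, if_pos ⟨h1, h2.le⟩, if_neg h2.ne, Option.bind_eq_some_iff]
  rfl

theorem chain_self (hn : 1 ≤ n) {u w : K.V} : chainB K n n u = some w ↔ K.F n u = some w := by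
  rw [chainB, if_pos ⟨hn, le_rfl⟩, if_pos rfl]

theorem chain_comm (H : SymCrystal n K σ) (hi : i ∈ Set.Icc 1 n) (hj : j ∈ Set.Icc 1 n)
    (hij : Far i j) :
    Comm (fun u v => chainB K n i u = some v) (fun u v => chainB K n j u = some v) := by
  wlog hlt : i < j generalizing i j
  · exact (this hj hi hij.symm (by unfold Far at hij; omega)).symm
  have hin : i < n := hlt.trans_le hj.2
  simp only [chain_lt hi.1 hin]
  have b1 := hi.1
  have b2 := hj.2
  rcases hj.2.eq_or_lt with rfl | hjn
  · simp only [chain_self hj.1]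
    refine Comm.comp (H.crystal.comm (mem_of_mem hi) (mem_of_mem hj) hij)
      (H.crystal.comm (compl_mem hi) (mem_of_mem hj) ?_)
    unfold Far at *
    omega
  · simp only [chain_lt hj.1 hjn]
    have c : ∀ {k}, k ∈ Set.Icc 1 (2 * n - 1) → Far k j → Far k (2 * n - j) →
        Comm (fun u v => K.F k u = some v) (Relation.Comp (fun u v => K.F j u = some v)
          (fun u v => K.F (2 * n - j) u = some v)) := fun hk f1 f2 =>
      (Comm.comp (H.crystal.comm hk (mem_of_mem hj) f1).symm
        (H.crystal.comm hk (compl_mem hj) f2).symm).symm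
    refine Comm.comp (c (mem_of_mem hi) hij ?_) (c (compl_mem hi) ?_ ?_) <;> unfold Far at * <;>
      omega

theorem chain_inj (H : SymCrystal n K σ) {u u' v : K.V} (e : chainB K n i u = some v)
    (e' : chainB K n i u' = some v) : u = u' := by
  have hi : 1 ≤ i ∧ i ≤ n := by
    by_contra hi
    rw [chainB, if_neg hi] at e
    cases e
  rcases hi.2.eq_or_lt with rfl | hlt
  · rw [chain_self hi.1] at e e'
    exact H.crystal.1.inj e e'
  · rw [chain_lt hi.1 hlt] at e e'
    obtain ⟨m, h1, h2⟩ := e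
    obtain ⟨m', h1', h2'⟩ := e'
    obtain rfl := H.crystal.1.inj h2 h2'
    exact H.crystal.1.inj h1 h1'

theorem chain_out (H : SymCrystal n K σ) (hi : i ∈ Set.Icc 1 n) {z : K.V}
    (e : chainB K n i u.1 = some z) : ∃ w, w.1 = z ∧ (extractB K n σ).F i u = some w := by
  have : ∃ m, K.F i u.1 = some m := by
    rcases hi.2.eq_or_lt with rfl | hlt
    · exact ⟨z, (chain_self hi.1).1 e⟩
    · obtain ⟨m, h1, -⟩ := (chain_lt hi.1 hlt).1 e
      exact ⟨m, h1⟩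
  obtain ⟨m, hm⟩ := this
  obtain ⟨w, hw⟩ := H.extract_exists_out hi hm
  refine ⟨w, ?_, hw⟩
  rw [extract_edge_iff, e] at hw
  exact (Option.some.inj hw).symm

theorem chain_in (H : SymCrystal n K σ) (hi : i ∈ Set.Icc 1 n) {z : K.V}
    (e : chainB K n i z = some u.1) : ∃ w, w.1 = z ∧ (extractB K n σ).F i w = some u := by
  have : ∃ m, K.F i m = some u.1 := by
    rcases hi.2.eq_or_lt with rfl | hlt
    · exact ⟨z, (chain_self hi.1).1 e⟩
    · obtain ⟨m, -, h2⟩ := (chain_lt hi.1 hlt).1 e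
      have h3 := H.edge' (mem_of_mem hi) h2
      rw [u.2] at h3
      exact ⟨σ m, h3⟩
  obtain ⟨m, hm⟩ := this
  obtain ⟨w, hw⟩ := H.extract_exists_in hi hm
  exact ⟨w, H.chain_inj (extract_edge_iff.1 hw) e, hw⟩

theorem extract_A5 (H : SymCrystal n K σ) (hi : i ∈ Set.Icc 1 n) (hj : j ∈ Set.Icc 1 n)
    (hij : Far i j) : A5at (extractB K n σ) i j := by
  have c := H.chain_comm hi hj hij
  refine A5at.of_comm H.extract_isColored.2.2.1 ⟨?_, ?_, ?_, ?_⟩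
  · intro u v v' e e'
    obtain ⟨w, h1, h2⟩ := c.down (extract_edge_iff.1 e) (extract_edge_iff.1 e')
    obtain ⟨w, rfl, h3⟩ := H.chain_out hj h1
    exact ⟨w, h3, extract_edge_iff.2 h2⟩
  · intro u u' v e e'
    obtain ⟨w, h1, h2⟩ := c.up (extract_edge_iff.1 e) (extract_edge_iff.1 e')
    obtain ⟨w, rfl, h3⟩ := H.chain_in hj h1
    exact ⟨w, h3, extract_edge_iff.2 h2⟩
  · intro u v v' e e'
    obtain ⟨w, h1, h2⟩ := c.mixed (extract_edge_iff.1 e) (extract_edge_iff.1 e')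
    obtain ⟨w, rfl, h3⟩ := H.chain_out hj h1
    exact ⟨w, h3, extract_edge_iff.2 h2⟩
  · intro u v v' e e'
    obtain ⟨w, h1, h2⟩ := c.mixed' (extract_edge_iff.1 e) (extract_edge_iff.1 e')
    obtain ⟨w, rfl, h3⟩ := H.chain_out hi h1
    exact ⟨w, h3, extract_edge_iff.2 h2⟩

theorem word_out (H : SymCrystal n K σ) {L : List ℕ} (hL : ∀ a ∈ L, 1 ≤ a ∧ a < n) {z : K.V}
    (p : wordPath (fun a => Relation.Comp (fun u v => K.F a u = some v)
      (fun u v => K.F (2 * n - a) u = some v)) L u.1 z) :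
    ∃ w, w.1 = z ∧ wordPath (fun a u v => (extractB K n σ).F a u = some v) L u w := by
  induction L generalizing u with
  | nil => exact ⟨u, p, rfl⟩
  | cons a L ih =>
    obtain ⟨y, h1, h2⟩ := p
    have ha := hL a (by simp)
    obtain ⟨y, rfl, h3⟩ := H.chain_out ⟨ha.1, ha.2.le⟩ ((chain_lt ha.1 ha.2).2 h1)
    obtain ⟨w, rfl, h4⟩ := ih (fun b hb => hL b (by simp [hb])) h2
    exact ⟨w, rfl, y, h3, h4⟩

theorem word_in (H : SymCrystal n K σ) {L : List ℕ} (hL : ∀ a ∈ L, 1 ≤ a ∧ a < n) {z : K.V}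
    (p : wordPath (fun a => Relation.Comp (fun u v => K.F a u = some v)
      (fun u v => K.F (2 * n - a) u = some v)) L z u.1) :
    ∃ w, w.1 = z ∧ wordPath (fun a u v => (extractB K n σ).F a u = some v) L w u := by
  induction L generalizing z with
  | nil => exact ⟨u, Eq.symm p, rfl⟩
  | cons a L ih =>
    obtain ⟨y, h1, h2⟩ := p
    have ha := hL a (by simp)
    obtain ⟨y, rfl, h4⟩ := ih (fun b hb => hL b (by simp [hb])) h2
    obtain ⟨w, rfl, h3⟩ := H.chain_in ⟨ha.1, ha.2.le⟩ ((chain_lt ha.1 ha.2).2 h1)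
    exact ⟨w, rfl, y, h3, h4⟩

theorem comm_compl (H : SymCrystal n K σ) {a b : ℕ} (ha : 1 ≤ a ∧ a < n) (hb : 1 ≤ b ∧ b < n) :
    Comm (fun u v => K.F a u = some v) (fun u v => K.F (2 * n - b) u = some v) :=
  H.crystal.comm (mem_of_mem ⟨ha.1, ha.2.le⟩) (compl_mem ⟨hb.1, hb.2.le⟩)
    (far_compl (by omega))

/-- Two words in the colors below `n` leading from a self-complementary vertex to a common vertex
of `K` also lead to a common vertex in the extract. -/
theorem words_out (H : SymCrystal n K σ) {L L' : List ℕ} (hL : ∀ a ∈ L, 1 ≤ a ∧ a < n)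
    (hL' : ∀ a ∈ L', 1 ≤ a ∧ a < n) {x : K.V}
    (p : wordPath (fun a u v => K.F a u = some v) L u.1 x)
    (p' : wordPath (fun a u v => K.F a u = some v) L' u.1 x) :
    ∃ w, wordPath (fun a u v => (extractB K n σ).F a u = some v) L u w ∧
      wordPath (fun a u v => (extractB K n σ).F a u = some v) L' u w := by
  have m : ∀ a u v, K.F a u = some v → K.F (2 * n - a) (σ u) = some (σ v) :=
    fun a u v => (H.edge a u v).1
  have q := wordPath_map (E' := fun a u v => K.F (2 * n - a) u = some v) m p
  have q' := wordPath_map (E' := fun a u v => K.F (2 * n - a) u = some v) m p'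
  rw [u.2] at q q'
  obtain ⟨w, h1, h2⟩ := (wordPath_comm₂ (E' := fun a u v => K.F (2 * n - a) u = some v)
    fun a ha b hb => H.comm_compl (hL a ha) (hL b hb)).down p q
  obtain ⟨w', h1', h2'⟩ := (wordPath_comm₂ (E' := fun a u v => K.F (2 * n - a) u = some v)
    fun a ha b hb => H.comm_compl (hL a ha) (hL' b hb)).down p q'
  obtain rfl := wordPath_functional (fun a u v v' e e' => Option.some.inj (e.symm.trans e')) h2 h2'
  obtain ⟨w, rfl, h3⟩ := H.word_out hL
    (wordPath_comp (fun a ha b hb => H.comm_compl (hL a ha) (hL b hb)) p h1)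
  obtain ⟨w', hw, h3'⟩ := H.word_out hL'
    (wordPath_comp (fun a ha b hb => H.comm_compl (hL' a ha) (hL' b hb)) p' h1')
  obtain rfl := Subtype.ext hw
  exact ⟨_, h3, h3'⟩

/-- The version of `words_out` for words leading to a self-complementary vertex. -/
theorem words_in (H : SymCrystal n K σ) {L L' : List ℕ} (hL : ∀ a ∈ L, 1 ≤ a ∧ a < n)
    (hL' : ∀ a ∈ L', 1 ≤ a ∧ a < n) {x : K.V}
    (p : wordPath (fun a u v => K.F a u = some v) L x u.1)
    (p' : wordPath (fun a u v => K.F a u = some v) L' x u.1) :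
    ∃ w, wordPath (fun a u v => (extractB K n σ).F a u = some v) L w u ∧
      wordPath (fun a u v => (extractB K n σ).F a u = some v) L' w u := by
  have m : ∀ a u v, K.F a u = some v → K.F (2 * n - a) (σ u) = some (σ v) :=
    fun a u v => (H.edge a u v).1
  have q := wordPath_map (E' := fun a u v => K.F (2 * n - a) u = some v) m p
  have q' := wordPath_map (E' := fun a u v => K.F (2 * n - a) u = some v) m p'
  rw [u.2] at q q'
  have c : ∀ {L L' : List ℕ}, (∀ a ∈ L, 1 ≤ a ∧ a < n) → (∀ a ∈ L', 1 ≤ a ∧ a < n) →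
      Comm (wordPath (fun a u v => K.F a u = some v) L)
        (wordPath (fun a u v => K.F (2 * n - a) u = some v) L') := fun hL hL' =>
    wordPath_comm₂ (E' := fun a u v => K.F (2 * n - a) u = some v)
      fun a ha b hb => H.comm_compl (hL a ha) (hL' b hb)
  obtain ⟨w, h1, h2⟩ := (c hL hL).up p q
  obtain ⟨w', h1', h2'⟩ := (c hL hL').up p q'
  obtain rfl := wordPath_injective (E := fun a u v => K.F a u = some v)
    (fun a u v v' e e' => H.crystal.1.inj e e') h2 h2'
  obtain ⟨y, h3, h4⟩ := (c hL hL).mixed' h1 p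
  obtain ⟨y', h3', h4'⟩ := (c hL' hL').mixed' h1' p'
  obtain ⟨w, rfl, h5⟩ := H.word_in hL
    (wordPath_comp (fun a ha b hb => H.comm_compl (hL a ha) (hL b hb)) h3 h4)
  obtain ⟨w', hw, h5'⟩ := H.word_in hL'
    (wordPath_comp (fun a ha b hb => H.comm_compl (hL' a ha) (hL' b hb)) h3' h4')
  obtain rfl := Subtype.ext hw
  exact ⟨_, h5, h5'⟩

end SymCrystal

/-! ### Pairs of neighboring colors below `n` in the extract -/

namespace SymCrystal

variable {n : ℕ} {K : PreGraph} {σ : K.V → K.V} {u v w : (extractB K n σ).V} {i j : ℕ}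

theorem extract_edge_down (H : SymCrystal n K σ) (hi : 1 ≤ i ∧ i < n) (hj : 1 ≤ j ∧ j < n)
    (e : (extractB K n σ).F i u = some w) :
    ∃ m, K.F i u.1 = some m ∧ K.F (2 * n - i) m = some w.1 ∧
      K.h j w.1 = K.h j m ∧ K.t j w.1 = K.t j m := by
  obtain ⟨m, h1, h2⟩ := (extract_edge_lt hi.1 hi.2).1 e
  have h3 := H.localCrystal.far (compl_mem ⟨hi.1, hi.2.le⟩) (mem_of_mem ⟨hj.1, hj.2.le⟩)
    (far_compl (by omega)).symm h2
  exact ⟨m, h1, h2, by omega, by omega⟩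

theorem extract_edge_up (H : SymCrystal n K σ) (hi : 1 ≤ i ∧ i < n) (hj : 1 ≤ j ∧ j < n)
    (e : (extractB K n σ).F i u = some w) :
    ∃ y, K.F i y = some w.1 ∧ K.h j y = K.h j u.1 := by
  obtain ⟨m, h1, h2⟩ := (extract_edge_lt hi.1 hi.2).1 e
  have h3 := H.edge_of_fixed u.2 h1
  have h4 := H.edge' (mem_of_mem ⟨hi.1, hi.2.le⟩) h2
  rw [w.2] at h4
  have h5 := H.localCrystal.far (compl_mem ⟨hi.1, hi.2.le⟩) (mem_of_mem ⟨hj.1, hj.2.le⟩)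
    (far_compl (by omega)).symm h3
  exact ⟨_, h4, by omega⟩

theorem extract_A2 (H : SymCrystal n K σ) (hi : 1 ≤ i ∧ i < n) (hj : 1 ≤ j ∧ j < n)
    (hij : i ≠ j) : A2at (extractB K n σ) i j := by
  have hi' := mem_of_mem ⟨hi.1, hi.2.le⟩
  have hj' := mem_of_mem ⟨hj.1, hj.2.le⟩
  have A := H.crystal.2.2.1 i hi' j hj' hij
  unfold A2at
  simp only [H.extract_h ⟨hj.1, hj.2.le⟩, H.extract_t ⟨hj.1, hj.2.le⟩]
  constructor
  · intro u w e
    obtain ⟨m, h1, -, h3, h4⟩ := H.extract_edge_down hi hj e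
    rw [h3, h4]
    exact A.1 _ _ h1
  · intro u v w e e'
    obtain ⟨m, h1, h2, h3, -⟩ := H.extract_edge_down hi hj e
    obtain ⟨m', h1', h2', h3', -⟩ := H.extract_edge_down hi hj e'
    obtain ⟨x, h4, h5⟩ := (H.comm_compl hi hi).mixed' h2 h1'
    have h6 := H.localCrystal.far (compl_mem ⟨hi.1, hi.2.le⟩) hj' (far_compl (by omega)).symm h5
    have h7 := A.2 _ _ _ h1 h4
    omega

theorem extract_A3 (H : SymCrystal n K σ) (hi : 1 ≤ i ∧ i < n) (hj : 1 ≤ j ∧ j < n)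
    (hij : Neighb i j) : A3at (extractB K n σ) i j := by
  have A := (H.crystal.2.2.2.1 i (mem_of_mem ⟨hi.1, hi.2.le⟩) j
    (mem_of_mem ⟨hj.1, hj.2.le⟩) hij).1
  have hw : ∀ a ∈ [i, j], 1 ≤ a ∧ a < n := by simp [hi, hj]
  have hw' : ∀ a ∈ [j, i], 1 ≤ a ∧ a < n := by simp [hi, hj]
  unfold A3at
  simp only [H.extract_h ⟨hj.1, hj.2.le⟩, H.extract_h ⟨hi.1, hi.2.le⟩]
  constructor
  · intro u v v' e e' hl
    obtain ⟨m, h1, -, h3, -⟩ := H.extract_edge_down hi hj e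
    obtain ⟨m', h1', -, h3', -⟩ := H.extract_edge_down hj hi e'
    obtain ⟨h4, x, h5, h6⟩ := A.1 _ _ _ h1 h1' (by omega)
    obtain ⟨w, ⟨y, h7, z, h8, rfl⟩, ⟨y', h9, z', h10, rfl⟩⟩ := H.words_out hw hw'
      ⟨m, h1, x, h5, rfl⟩ ⟨m', h1', x, h6, rfl⟩
    obtain rfl := Option.some.inj (e.symm.trans h7)
    obtain rfl := Option.some.inj (e'.symm.trans h9)
    exact ⟨by omega, _, h8, h10⟩
  · intro u u' v e e' hl
    obtain ⟨m, h1, h3⟩ := H.extract_edge_up hi hj e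
    obtain ⟨m', h1', h3'⟩ := H.extract_edge_up hj hi e'
    obtain ⟨h4, x, h5, h6⟩ := A.2 _ _ _ h1 h1' (by omega)
    obtain ⟨w, ⟨y, h7, z, h8, rfl⟩, ⟨y', h9, z', h10, h11⟩⟩ := H.words_in hw' hw
      ⟨m, h5, _, h1, rfl⟩ ⟨m', h6, _, h1', rfl⟩
    obtain rfl := H.extract_isColored.inj e h8
    rw [h11] at h10
    obtain rfl := H.extract_isColored.inj e' h10
    exact ⟨by omega, _, h7, h9⟩

theorem extract_A4 (H : SymCrystal n K σ) (hi : 1 ≤ i ∧ i < n) (hj : 1 ≤ j ∧ j < n)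
    (hij : Neighb i j) : A4at (extractB K n σ) i j := by
  have A := (H.crystal.2.2.2.1 i (mem_of_mem ⟨hi.1, hi.2.le⟩) j
    (mem_of_mem ⟨hj.1, hj.2.le⟩) hij).2
  have hw : ∀ a ∈ [i, j, j, i], 1 ≤ a ∧ a < n := by simp [hi, hj]
  have hw' : ∀ a ∈ [j, i, i, j], 1 ≤ a ∧ a < n := by simp [hi, hj]
  unfold A4at at A ⊢
  simp only [H.extract_h ⟨hj.1, hj.2.le⟩, H.extract_h ⟨hi.1, hi.2.le⟩]
  simp only [Option.bind_eq_some_iff, PreGraph.finv_eq_some (H.crystal.1.2.2.1 _),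
    PreGraph.finv_eq_some (H.extract_isColored.2.2.1 _)] at A ⊢
  constructor
  · intro u v v' e e' hl hl'
    obtain ⟨m, h1, -, h3, -⟩ := H.extract_edge_down hi hj e
    obtain ⟨m', h1', -, h3', -⟩ := H.extract_edge_down hj hi e'
    obtain ⟨x, ⟨c, ⟨b, ⟨a, p1, p2⟩, p3⟩, p4⟩, ⟨c', ⟨b', ⟨a', p1', p2'⟩, p3'⟩, p4'⟩⟩ :=
      A.1 _ _ _ h1 h1' (by omega) (by omega)
    obtain ⟨w, ⟨a, q1, b, q2, c, q3, d, q4, rfl⟩, ⟨a', q1', b', q2', c', q3', d', q4', rfl⟩⟩ :=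
      H.words_out hw hw' ⟨_, p1, _, p2, _, p3, _, p4, rfl⟩ ⟨_, p1', _, p2', _, p3', _, p4', rfl⟩
    exact ⟨_, ⟨_, ⟨_, ⟨_, q1, q2⟩, q3⟩, q4⟩, ⟨_, ⟨_, ⟨_, q1', q2'⟩, q3'⟩, q4'⟩⟩
  · intro u u' v e e' hl hl'
    obtain ⟨m, h1, h3⟩ := H.extract_edge_up hi hj e
    obtain ⟨m', h1', h3'⟩ := H.extract_edge_up hj hi e'
    obtain ⟨x, ⟨c, ⟨b, ⟨a, p1, p2⟩, p3⟩, p4⟩, ⟨c', ⟨b', ⟨a', p1', p2'⟩, p3'⟩, p4'⟩⟩ :=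
      A.2 _ _ _ h1 h1' (by omega) (by omega)
    obtain ⟨w, ⟨a, q1, b, q2, c, q3, d, q4, hd⟩, ⟨a', q1', b', q2', c', q3', d', q4', hd'⟩⟩ :=
      H.words_in hw hw' ⟨_, p4, _, p3, _, p2, _, p1, rfl⟩ ⟨_, p4', _, p3', _, p2', _, p1', rfl⟩
    rw [hd] at q4
    rw [hd'] at q4'
    exact ⟨_, ⟨_, ⟨_, ⟨_, q4, q3⟩, q2⟩, q1⟩, ⟨_, ⟨_, ⟨_, q4', q3'⟩, q2'⟩, q1'⟩⟩

end SymCrystal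

/-! ### Subcrystals -/

section Sub

variable {B : PreGraph} {C I : Set ℕ} {v : B.V} {i j : ℕ} {x y : (B.sub I v).V}

theorem sub_edge_iff : (B.sub I v).F i x = some y ↔ i ∈ I ∧ B.F i x.1 = some y.1 := by
  by_cases hi : i ∈ I
  · have : (B.sub I v).F i x = _ := dif_pos hi
    rw [this]
    refine Option.pbind_eq_some_iff.trans ?_
    constructor
    · rintro ⟨b, hb, e⟩
      rw [← Option.some.inj e]
      exact ⟨hi, hb⟩
    · rintro ⟨-, e⟩
      exact ⟨y.1, e, rfl⟩
  · have : (B.sub I v).F i x = none := dif_neg hi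
    simp [this, hi]

theorem sub_exists_out (hi : i ∈ I) {b : B.V} (e : B.F i x.1 = some b) :
    ∃ y : (B.sub I v).V, y.1 = b :=
  ⟨⟨b, x.2.tail ⟨i, hi, Or.inl e⟩⟩, rfl⟩

theorem sub_exists_in (hi : i ∈ I) {b : B.V} (e : B.F i b = some x.1) :
    ∃ y : (B.sub I v).V, y.1 = b :=
  ⟨⟨b, x.2.tail ⟨i, hi, Or.inr e⟩⟩, rfl⟩

theorem sub_isColored (hB : IsColored B C) : IsColored (B.sub I v) I := by
  have := hB.1
  refine ⟨Subtype.finite, fun i hi x => dif_neg hi, ?_, ?_⟩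
  · intro i u u' w e e'
    exact Subtype.ext (hB.inj (sub_edge_iff.1 e).2 (sub_edge_iff.1 e').2)
  · intro i w k hk
    exact optIter_no_cycle_of_grade (T := fun w => B.t i w.1)
      (fun a b e => hB.t_succ (sub_edge_iff.1 e).2) hk w

theorem sub_h (hB : IsColored B C) (hi : i ∈ I) (x : (B.sub I v).V) :
    (B.sub I v).h i x = B.h i x.1 := by
  refine (sub_isColored hB).h_unique (H := fun x => B.h i x.1)
    (fun a b e => hB.h_succ (sub_edge_iff.1 e).2) (fun a e => IsColored.h_eq_zero B ?_) x
  by_contra hne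
  obtain ⟨b, hb⟩ := Option.ne_none_iff_exists'.1 hne
  obtain ⟨b, rfl⟩ := sub_exists_out hi hb
  rw [sub_edge_iff.2 ⟨hi, hb⟩] at e
  cases e

theorem sub_t (hB : IsColored B C) (hi : i ∈ I) (x : (B.sub I v).V) :
    (B.sub I v).t i x = B.t i x.1 := by
  refine (sub_isColored hB).t_unique (T := fun x => B.t i x.1)
    (fun a b e => hB.t_succ (sub_edge_iff.1 e).2)
    (fun a e => IsColored.t_eq_zero B fun b hb => ?_) x
  obtain ⟨b, rfl⟩ := sub_exists_in hi hb
  exact e b (sub_edge_iff.2 ⟨hi, hb⟩)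

theorem sub_connected : (B.sub I v).Connected := by
  have key : ∀ x : (B.sub I v).V,
      Relation.ReflTransGen (B.sub I v).Step ⟨v, .refl⟩ x := by
    rintro ⟨x, hx⟩
    induction hx with
    | refl => exact .refl
    | tail h1 h2 ih =>
      refine ih.tail ?_
      obtain ⟨i, hi, e | e⟩ := h2
      · exact ⟨i, Or.inl (sub_edge_iff.2 ⟨hi, e⟩)⟩
      · exact ⟨i, Or.inr (sub_edge_iff.2 ⟨hi, e⟩)⟩
  have : Std.Symm (B.sub I v).Step := ⟨fun a b ⟨i, e⟩ => ⟨i, e.symm⟩⟩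
  exact fun u w => (symm (key u)).trans (key w)

theorem sub_A2 (hB : IsColored B C) (hi : i ∈ I) (hj : j ∈ I) (A : A2at B i j) :
    A2at (B.sub I v) i j := by
  unfold A2at
  simp only [sub_h hB hj, sub_t hB hj, sub_edge_iff, hi, true_and]
  exact ⟨fun u w e => A.1 _ _ e, fun u v w e e' => A.2 _ _ _ e e'⟩

theorem sub_A3 (hB : IsColored B C) (hi : i ∈ I) (hj : j ∈ I) (A : A3at B i j) :
    A3at (B.sub I v) i j := by
  unfold A3at
  simp only [sub_h hB hj, sub_h hB hi, sub_edge_iff, hi, hj, true_and]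
  constructor
  · intro u v v' e e' hl
    obtain ⟨h1, w, h2, h3⟩ := A.1 _ _ _ e e' hl
    obtain ⟨w, rfl⟩ := sub_exists_out hj h2
    exact ⟨h1, w, h2, h3⟩
  · intro u u' v e e' hl
    obtain ⟨h1, w, h2, h3⟩ := A.2 _ _ _ e e' hl
    obtain ⟨w, rfl⟩ := sub_exists_in hj h2
    exact ⟨h1, w, h2, h3⟩

theorem sub_A4 (hB : IsColored B C) (hi : i ∈ I) (hj : j ∈ I) (A : A4at B i j) :
    A4at (B.sub I v) i j := by
  unfold A4at at A ⊢
  simp only [sub_h hB hj, sub_h hB hi]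
  simp only [Option.bind_eq_some_iff, PreGraph.finv_eq_some (hB.2.2.1 _),
    PreGraph.finv_eq_some ((sub_isColored hB).2.2.1 _),
    sub_edge_iff, hi, hj, true_and] at A ⊢
  constructor
  · intro u v v' e e' hl hl'
    obtain ⟨x, ⟨c, ⟨b, ⟨a, p1, p2⟩, p3⟩, p4⟩, ⟨c', ⟨b', ⟨a', p1', p2'⟩, p3'⟩, p4'⟩⟩ :=
      A.1 _ _ _ e e' hl hl'
    obtain ⟨a, rfl⟩ := sub_exists_out hi p1
    obtain ⟨b, rfl⟩ := sub_exists_out hj p2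
    obtain ⟨c, rfl⟩ := sub_exists_out hj p3
    obtain ⟨x, rfl⟩ := sub_exists_out hi p4
    obtain ⟨a', rfl⟩ := sub_exists_out hj p1'
    obtain ⟨b', rfl⟩ := sub_exists_out hi p2'
    obtain ⟨c', rfl⟩ := sub_exists_out hi p3'
    exact ⟨x, ⟨c, ⟨b, ⟨a, p1, p2⟩, p3⟩, p4⟩, ⟨c', ⟨b', ⟨a', p1', p2'⟩, p3'⟩, p4'⟩⟩
  · intro u u' v e e' hl hl'
    obtain ⟨x, ⟨c, ⟨b, ⟨a, p1, p2⟩, p3⟩, p4⟩, ⟨c', ⟨b', ⟨a', p1', p2'⟩, p3'⟩, p4'⟩⟩ :=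
      A.2 _ _ _ e e' hl hl'
    obtain ⟨a, rfl⟩ := sub_exists_in hi p1
    obtain ⟨b, rfl⟩ := sub_exists_in hj p2
    obtain ⟨c, rfl⟩ := sub_exists_in hj p3
    obtain ⟨x, rfl⟩ := sub_exists_in hi p4
    obtain ⟨a', rfl⟩ := sub_exists_in hj p1'
    obtain ⟨b', rfl⟩ := sub_exists_in hi p2'
    obtain ⟨c', rfl⟩ := sub_exists_in hi p3'
    exact ⟨x, ⟨c, ⟨b, ⟨a, p1, p2⟩, p3⟩, p4⟩, ⟨c', ⟨b', ⟨a', p1', p2'⟩, p3'⟩, p4'⟩⟩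

end Sub

theorem SymCrystal.sub_isCrystalOn {n : ℕ} {K : PreGraph} {σ : K.V → K.V}
    (H : SymCrystal n K σ) {i j : ℕ} (hi : 1 ≤ i ∧ i < n) (hj : 1 ≤ j ∧ j < n)
    (hij : Neighb i j) (v : (extractB K n σ).V) :
    IsCrystalOn ((extractB K n σ).sub {i, j} v) {i, j} := by
  have hmem : ∀ a ∈ ({i, j} : Set ℕ), 1 ≤ a ∧ a < n := by
    rintro a (rfl | rfl)
    · exact hi
    · exact hj
  have hB := H.extract_isColored
  refine ⟨sub_isColored hB, sub_connected, ?_, ?_, ?_⟩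
  · intro a ha b hb hab
    exact sub_A2 hB ha hb (H.extract_A2 (hmem a ha) (hmem b hb) hab)
  · intro a ha b hb hab
    exact ⟨sub_A3 hB ha hb (H.extract_A3 (hmem a ha) (hmem b hb) hab),
      sub_A4 hB ha hb (H.extract_A4 (hmem a ha) (hmem b hb) hab)⟩
  · rintro a (rfl | rfl) b (rfl | rfl) hab <;> unfold Far at hab <;> unfold Neighb at hij <;> omega

/-! ### Folding a crystal of rank three -/

/-- The graph with edges `F₁`, `F₂` on `S` is embedded in a three-colored graph so that `F₁` is the
composition of the colors `1` and `3`, and `F₂` is the color `2`. -/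
structure Folded {V S : Type} (E : ℕ → V → V → Prop) (ι : S → V) (F₁ F₂ : S → S → Prop)
    (s : S) : Prop where
  inj : Function.Injective ι
  edge_one : ∀ a b, F₁ a b ↔ ∃ m, E 1 (ι a) m ∧ E 3 m (ι b)
  edge_two : ∀ a b, F₂ a b ↔ E 2 (ι a) (ι b)
  out_one : ∀ a m, E 1 (ι a) m → ∃ b, F₁ a b
  out_two : ∀ a m, E 2 (ι a) m → ∃ b, F₂ a b
  reach : ∀ a, Relation.ReflTransGen (fun a b => F₁ a b ∨ F₂ a b) s a

namespace Folded

variable {V S V' S' : Type} {E : ℕ → V → V → Prop} {ι : S → V} {F₁ F₂ : S → S → Prop} {s : S}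
  {E' : ℕ → V' → V' → Prop} {ι' : S' → V'} {F₁' F₂' : S' → S' → Prop} {s' : S'}
  {h t : ℕ → V → ℤ} {h' t' : ℕ → V' → ℤ}

theorem step_one (A' : Folded E' ι' F₁' F₂' s') (A : Folded E ι F₁ F₂ s)
    (L : LocalCrystal 3 E h t) (L' : LocalCrystal 3 E' h' t')
    (hs : IsHighest 3 t (ι s)) (hs' : IsHighest 3 t' (ι' s'))
    (hh : ∀ i ∈ Set.Icc 1 3, h i (ι s) = h' i (ι' s')) {d : ℕ} {a b : S} {a' : S'}
    (m : Match 3 E E' (ι s) (ι' s') d (ι a) (ι' a')) (e : F₁ a b) :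
    ∃ b', F₁' a' b' ∧ ∃ k, Match 3 E E' (ι s) (ι' s') k (ι b) (ι' b') := by
  obtain ⟨x, e1, e2⟩ := (A.edge_one a b).1 e
  obtain ⟨x', e1', m1⟩ := match_step L L' hs hs' hh m (by simp) e1
  obtain ⟨y', e2', m2⟩ := match_step L L' hs hs' hh m1 (by simp) e2
  obtain ⟨b', hb⟩ := A'.out_one a' x' e1'
  obtain ⟨z, e3, e4⟩ := (A'.edge_one a' b').1 hb
  obtain rfl := L'.out_unique (by simp) e1' e3
  obtain rfl := L'.out_unique (by simp) e2' e4
  exact ⟨b', hb, _, m2⟩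

theorem step_two (A' : Folded E' ι' F₁' F₂' s') (A : Folded E ι F₁ F₂ s)
    (L : LocalCrystal 3 E h t) (L' : LocalCrystal 3 E' h' t')
    (hs : IsHighest 3 t (ι s)) (hs' : IsHighest 3 t' (ι' s'))
    (hh : ∀ i ∈ Set.Icc 1 3, h i (ι s) = h' i (ι' s')) {d : ℕ} {a b : S} {a' : S'}
    (m : Match 3 E E' (ι s) (ι' s') d (ι a) (ι' a')) (e : F₂ a b) :
    ∃ b', F₂' a' b' ∧ ∃ k, Match 3 E E' (ι s) (ι' s') k (ι b) (ι' b') := by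
  obtain ⟨x', e1', m1⟩ := match_step L L' hs hs' hh m (by simp) ((A.edge_two a b).1 e)
  obtain ⟨b', hb⟩ := A'.out_two a' x' e1'
  obtain rfl := L'.out_unique (by simp) e1' ((A'.edge_two a' b').1 hb)
  exact ⟨b', hb, _, m1⟩

theorem exists_match (A' : Folded E' ι' F₁' F₂' s') (A : Folded E ι F₁ F₂ s)
    (L : LocalCrystal 3 E h t) (L' : LocalCrystal 3 E' h' t')
    (hs : IsHighest 3 t (ι s)) (hs' : IsHighest 3 t' (ι' s'))
    (hh : ∀ i ∈ Set.Icc 1 3, h i (ι s) = h' i (ι' s')) (a : S) :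
    ∃ a' d, Match 3 E E' (ι s) (ι' s') d (ι a) (ι' a') := by
  induction A.reach a with
  | refl => exact ⟨s', 0, .base⟩
  | tail _ e ih =>
    obtain ⟨a', d, m⟩ := ih
    rcases e with e | e
    · obtain ⟨b', -, hb⟩ := A'.step_one A L L' hs hs' hh m e
      exact ⟨b', hb⟩
    · obtain ⟨b', -, hb⟩ := A'.step_two A L L' hs hs' hh m e
      exact ⟨b', hb⟩

/-- Foldings of crystals with the same parameter are isomorphic. -/
theorem exists_equiv (A : Folded E ι F₁ F₂ s) (A' : Folded E' ι' F₁' F₂' s')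
    (L : LocalCrystal 3 E h t) (L' : LocalCrystal 3 E' h' t')
    (hs : IsHighest 3 t (ι s)) (hs' : IsHighest 3 t' (ι' s'))
    (hh : ∀ i ∈ Set.Icc 1 3, h i (ι s) = h' i (ι' s')) :
    ∃ e : S ≃ S', ∀ a b, (F₁ a b ↔ F₁' (e a) (e b)) ∧ (F₂ a b ↔ F₂' (e a) (e b)) := by
  have hh' : ∀ i ∈ Set.Icc 1 3, h' i (ι' s') = h i (ι s) := fun i hi => (hh i hi).symm
  choose f d hf using A'.exists_match A L L' hs hs' hh
  choose g k hg using A.exists_match A' L' L hs' hs hh'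
  have uniq : ∀ {a a' b' c c'}, Match 3 E E' (ι s) (ι' s') c (ι a) (ι' a') →
      Match 3 E E' (ι s) (ι' s') c' (ι a) (ι' b') → a' = b' := fun m m' =>
    A'.inj (match_functional L L' hs hs' hh m' m)
  have uniq' : ∀ {a b a' c c'}, Match 3 E E' (ι s) (ι' s') c (ι a) (ι' a') →
      Match 3 E E' (ι s) (ι' s') c' (ι b) (ι' a') → a = b := fun m m' =>
    A.inj (match_functional L' L hs' hs hh' m'.swap m.swap)
  refine ⟨⟨f, g, fun a => uniq' (hg (f a)).swap (hf a), fun a' => uniq (hf (g a')) (hg a').swap⟩,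
    fun a b => ⟨⟨fun e => ?_, fun e => ?_⟩, ⟨fun e => ?_, fun e => ?_⟩⟩⟩
  · obtain ⟨b', h1, c, m⟩ := A'.step_one A L L' hs hs' hh (hf a) e
    obtain rfl := uniq m (hf b)
    exact h1
  · obtain ⟨b', h1, c, m⟩ := A.step_one A' L' L hs' hs hh' (hf a).swap e
    obtain rfl := uniq' m.swap (hf b)
    exact h1
  · obtain ⟨b', h1, c, m⟩ := A'.step_two A L L' hs hs' hh (hf a) e
    obtain rfl := uniq m (hf b)
    exact h1
  · obtain ⟨b', h1, c, m⟩ := A.step_two A' L' L hs' hs hh' (hf a).swap e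
    obtain rfl := uniq' m.swap (hf b)
    exact h1

end Folded

/-! ### The worm graph as a folding -/

section WormFold

variable {g1 g2 : ℕ}

/-- The point of the polyhedral model given by a vertex of the worm graph. -/
def wormVertex (w : (WormGraph g1 g2).V) : Model g1 g2 := ⟨wormPt w.1, wormPt_ok w.2⟩

theorem wormVertex_injective : Function.Injective (wormVertex (g1 := g1) (g2 := g2)) :=
  fun w w' e => Subtype.ext (wormPt_injective w.2 w'.2 (congrArg Subtype.val e))

theorem wormGraph_one_iff {w w' : (WormGraph g1 g2).V} :
    (WormGraph g1 g2).F 1 w = some w' ↔ w'.1 = worm1 w.1 := by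
  change (if h1 : WormOK g1 g2 (worm1 w.1) then some (⟨worm1 w.1, h1⟩ : (WormGraph g1 g2).V)
    else none) = some w' ↔ _
  constructor
  · intro h
    split_ifs at h
    rw [← Option.some.inj h]
  · intro h
    have h1 : WormOK g1 g2 (worm1 w.1) := h ▸ w'.2
    rw [dif_pos h1]
    exact congrArg some (Subtype.ext h.symm)

theorem wormGraph_two_iff {w w' : (WormGraph g1 g2).V} :
    (WormGraph g1 g2).F 2 w = some w' ↔ w'.1 = worm2 w.1 := by
  change (if h2 : WormOK g1 g2 (worm2 w.1) then some (⟨worm2 w.1, h2⟩ : (WormGraph g1 g2).V)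
    else none) = some w' ↔ _
  constructor
  · intro h
    split_ifs at h
    rw [← Option.some.inj h]
  · intro h
    have h1 : WormOK g1 g2 (worm2 w.1) := h ▸ w'.2
    rw [dif_pos h1]
    exact congrArg some (Subtype.ext h.symm)

theorem wormGraph_reach (w : (WormGraph g1 g2).V) :
    Relation.ReflTransGen (fun a b => (WormGraph g1 g2).F 1 a = some b ∨
      (WormGraph g1 g2).F 2 a = some b) ⟨0, wormOK_zero⟩ w := by
  obtain ⟨w, hw⟩ := w
  induction m : (wormSum w).toNat using Nat.strong_induction_on generalizing w with
  | _ m ih =>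
    by_cases h0 : w = 0
    · subst h0
      exact .refl
    · obtain ⟨u, hu, e⟩ := worm_pred hw h0
      have hn := wormSum_nonneg hu
      rcases e with e | e
      · have hlt := wormSum_worm1 (w := u)
        rw [e] at hlt
        exact (ih _ (by omega) u hu rfl).tail (Or.inl (wormGraph_one_iff.2 e.symm))
      · have hlt := wormSum_worm2 (w := u)
        rw [e] at hlt
        exact (ih _ (by omega) u hu rfl).tail (Or.inr (wormGraph_two_iff.2 e.symm))

theorem wormGraph_folded : Folded (Model.E g1 g2) wormVertex
    (fun a b => (WormGraph g1 g2).F 1 a = some b) (fun a b => (WormGraph g1 g2).F 2 a = some b)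
    ⟨0, wormOK_zero⟩ where
  inj := wormVertex_injective
  edge_one a b := by
    rw [wormGraph_one_iff]
    constructor
    · intro h
      have h0 : 0 < (wormPt a.1).h g1 g2 1 := (worm1_ok_iff a.2).1 (h ▸ b.2)
      have e1 := Model.edge_f (i := 1) (by simp) (wormVertex a) h0
      have h3 := ((Model.localCrystal g1 g2).far (i := 1) (j := 3) (by simp) (by simp)
        (by unfold Far; omega) e1).1
      refine ⟨_, e1, lt_of_lt_of_eq h0 (wormPt_h_three.symm.trans ?_), ?_⟩
      · exact h3.symm
      · exact (congrArg wormPt h).trans (wormPt_worm1 a.2)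
    · rintro ⟨m, ⟨h0, hm⟩, -, hb⟩
      have h1 := (worm1_ok_iff a.2).2 h0
      refine wormPt_injective b.2 h1 (Eq.trans hb ?_)
      rw [hm, wormPt_worm1 a.2]
      rfl
  edge_two a b := by
    rw [wormGraph_two_iff]
    constructor
    · intro h
      exact ⟨(worm2_ok_iff a.2).1 (h ▸ b.2), (congrArg wormPt h).trans (wormPt_worm2 a.2)⟩
    · rintro ⟨h0, hb⟩
      exact wormPt_injective b.2 ((worm2_ok_iff a.2).2 h0)
        (Eq.trans hb (wormPt_worm2 a.2).symm)
  out_one a m e := ⟨⟨_, (worm1_ok_iff a.2).2 e.1⟩, wormGraph_one_iff.2 rfl⟩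
  out_two a m e := ⟨⟨_, (worm2_ok_iff a.2).2 e.1⟩, wormGraph_two_iff.2 rfl⟩
  reach := wormGraph_reach

theorem wormPt_zero : wormPt 0 = ⟨0, 0, 0, 0, 0, 0⟩ := rfl

end WormFold

namespace SymCrystal

variable {n : ℕ} {K : PreGraph} {σ : K.V → K.V} {v : (extractB K n σ).V}

/-- Edges of the last two colors of the extract, in terms of three colors of `K`. -/
theorem sub_edge_one (H : SymCrystal n K σ) {a b : ((extractB K n σ).sub {n - 1, n} v).V} :
    ((extractB K n σ).sub {n - 1, n} v).F (n - 1) a = some b ↔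
      ∃ m, K.F (n - 2 + 1) a.1.1 = some m ∧ K.F (n - 2 + 3) m = some b.1.1 := by
  have hn := H.two_le
  refine sub_edge_iff.trans ?_
  rw [extract_edge_lt (by omega) (by omega)]
  simp only [Set.mem_insert_iff, true_or, true_and]
  rw [show 2 * n - (n - 1) = n - 2 + 3 by omega, show n - 2 + 1 = n - 1 by omega]

theorem sub_edge_two (H : SymCrystal n K σ) {a b : ((extractB K n σ).sub {n - 1, n} v).V} :
    ((extractB K n σ).sub {n - 1, n} v).F n a = some b ↔
      K.F (n - 2 + 2) a.1.1 = some b.1.1 := by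
  have hn := H.two_le
  refine sub_edge_iff.trans ?_
  rw [extract_edge_self (by omega)]
  simp only [Set.mem_insert_iff, Set.mem_singleton_iff, or_true, true_and]
  rw [show n - 2 + 2 = n by omega]

theorem sub_out (H : SymCrystal n K σ) {i : ℕ} (hi : i ∈ ({n - 1, n} : Set ℕ))
    {a : ((extractB K n σ).sub {n - 1, n} v).V} {m : K.V} (e : K.F i a.1.1 = some m) :
    ∃ b, ((extractB K n σ).sub {n - 1, n} v).F i a = some b := by
  have hn := H.two_le
  have hi' : i ∈ Set.Icc 1 n := by
    rcases hi with rfl | rfl <;> constructor <;> omega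
  obtain ⟨b, hb⟩ := H.extract_exists_out hi' e
  obtain ⟨b, rfl⟩ := sub_exists_out hi hb
  exact ⟨b, sub_edge_iff.2 ⟨hi, hb⟩⟩

theorem sub_in (H : SymCrystal n K σ) {i : ℕ} (hi : i ∈ ({n - 1, n} : Set ℕ))
    {a : ((extractB K n σ).sub {n - 1, n} v).V} {m : K.V} (e : K.F i m = some a.1.1) :
    ∃ b, ((extractB K n σ).sub {n - 1, n} v).F i b = some a := by
  have hn := H.two_le
  have hi' : i ∈ Set.Icc 1 n := by
    rcases hi with rfl | rfl <;> constructor <;> omega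
  obtain ⟨b, hb⟩ := H.extract_exists_in hi' e
  obtain ⟨b, rfl⟩ := sub_exists_in hi hb
  exact ⟨b, sub_edge_iff.2 ⟨hi, hb⟩⟩

theorem sub_localCrystal (H : SymCrystal n K σ) :
    LocalCrystal 3 (fun i u v => K.F (n - 2 + i) u = some v)
      (fun i u => (K.h (n - 2 + i) u : ℤ)) (fun i u => (K.t (n - 2 + i) u : ℤ)) :=
  H.crystal.localCrystal (o := n - 2) (N := 3) (by have := H.two_le; omega)

theorem sub_isHighest (H : SymCrystal n K σ) {s : ((extractB K n σ).sub {n - 1, n} v).V}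
    (hs : ∀ i u, ((extractB K n σ).sub {n - 1, n} v).F i u ≠ some s) :
    IsHighest 3 (fun i u => (K.t (n - 2 + i) u : ℤ)) s.1.1 := by
  have hn := H.two_le
  have key : ∀ i ∈ ({n - 1, n} : Set ℕ), ∀ m, K.F i m ≠ some s.1.1 := fun i hi m e =>
    (H.sub_in hi e).elim fun b hb => hs i b hb
  intro i hi
  refine Nat.cast_eq_zero.2 (IsColored.t_eq_zero K ?_)
  intro m e
  rcases mem_Icc_three hi with rfl | rfl | rfl
  · exact key _ (Or.inl (by omega)) m e
  · exact key _ (Or.inr (by change _ = _; omega)) m e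
  · exact key (2 * n - (n - 2 + 3)) (Or.inl (by omega)) _ (H.edge_to_fixed s.1.2 e)

theorem sub_color {a b : ((extractB K n σ).sub {n - 1, n} v).V}
    (e : ∃ i, ((extractB K n σ).sub {n - 1, n} v).F i a = some b) :
    ((extractB K n σ).sub {n - 1, n} v).F (n - 1) a = some b ∨
      ((extractB K n σ).sub {n - 1, n} v).F n a = some b := by
  obtain ⟨i, e⟩ := e
  rcases (sub_edge_iff.1 e).1 with h | h
  · exact Or.inl (h ▸ e)
  · exact Or.inr (h ▸ e)

theorem sub_reach (H : SymCrystal n K σ) :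
    ∃ s : ((extractB K n σ).sub {n - 1, n} v).V,
      IsHighest 3 (fun i u => (K.t (n - 2 + i) u : ℤ)) s.1.1 ∧
      ∀ a, Relation.ReflTransGen (fun a b =>
        ((extractB K n σ).sub {n - 1, n} v).F (n - 1) a = some b ∨
        ((extractB K n σ).sub {n - 1, n} v).F n a = some b) s a := by
  have hn := H.two_le
  have := H.finite
  have : Finite ((extractB K n σ).sub {n - 1, n} v).V :=
    (sub_isColored H.extract_isColored).1
  have top := exists_source_reach (wellFounded_of_rank _
    (fun a b (e : ∃ i, ((extractB K n σ).sub {n - 1, n} v).F i a = some b) =>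
      H.extract_rank (sub_edge_iff.1 e.choose_spec).2))
  obtain ⟨s, h1, -⟩ := top ⟨v, .refl⟩
  have hs := H.sub_isHighest (s := s) fun i u e => h1 u ⟨i, e⟩
  refine ⟨s, hs, fun a => ?_⟩
  obtain ⟨s', h1', h2'⟩ := top a
  have hs' := H.sub_isHighest (s := s') fun i u e => h1' u ⟨i, e⟩
  have hlift : Relation.ReflTransGen (fun a b => ∃ i ∈ Set.Icc 1 3,
      K.F (n - 2 + i) a = some b ∨ K.F (n - 2 + i) b = some a) s.1.1 s'.1.1 := by
    have hstep : ∀ a b : ((extractB K n σ).sub {n - 1, n} v).V,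
        (∃ i, ((extractB K n σ).sub {n - 1, n} v).F i a = some b) →
        Relation.ReflTransGen (fun a b => ∃ i ∈ Set.Icc 1 3,
          K.F (n - 2 + i) a = some b ∨ K.F (n - 2 + i) b = some a) a.1.1 b.1.1 := by
      intro a b e
      rcases sub_color e with e | e
      · obtain ⟨m, e1, e2⟩ := H.sub_edge_one.1 e
        exact (Relation.ReflTransGen.single ⟨1, by simp, Or.inl e1⟩).tail
          ⟨3, by simp, Or.inl e2⟩
      · exact .single ⟨2, by simp, Or.inl (H.sub_edge_two.1 e)⟩
    have : Std.Symm (fun a b => ∃ i ∈ Set.Icc 1 3,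
        K.F (n - 2 + i) a = some b ∨ K.F (n - 2 + i) b = some a) :=
      ⟨fun a b ⟨i, hi, e⟩ => ⟨i, hi, e.symm⟩⟩
    refine Relation.ReflTransGen.lift'
      (fun a : ((extractB K n σ).sub {n - 1, n} v).V => a.1.1) ?_ s s' (sub_connected s s')
    rintro a b ⟨i, e | e⟩
    · exact hstep a b ⟨i, e⟩
    · exact symm (hstep b a ⟨i, e⟩)
  have heq := H.sub_localCrystal.top_unique hlift hs hs' .refl .refl
  obtain rfl : s = s' := Subtype.ext (Subtype.ext heq)
  exact Relation.ReflTransGen.mono (fun a b e => sub_color e) _ _ h2'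

theorem sub_isoVia (H : SymCrystal n K σ) (v : (extractB K n σ).V) : ∃ g1 g2 : ℕ,
    IsoVia ((extractB K n σ).sub {n - 1, n} v) (WormGraph g1 g2)
      (fun x => if x = n - 1 then 1 else if x = n then 2 else 0) := by
  have hn := H.two_le
  obtain ⟨s, hs, hr⟩ := H.sub_reach (v := v)
  have A : Folded (fun i u v => K.F (n - 2 + i) u = some v) (fun a => a.1.1)
      (fun a b => ((extractB K n σ).sub {n - 1, n} v).F (n - 1) a = some b)
      (fun a b => ((extractB K n σ).sub {n - 1, n} v).F n a = some b) s :=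
    { inj := fun a b e => Subtype.ext (Subtype.ext e)
      edge_one := fun a b => H.sub_edge_one
      edge_two := fun a b => H.sub_edge_two
      out_one := fun a m e => H.sub_out (Or.inl rfl)
        (by rwa [show n - 2 + 1 = n - 1 by omega] at e)
      out_two := fun a m e => H.sub_out (Or.inr rfl)
        (by rwa [show n - 2 + 2 = n by omega] at e)
      reach := hr }
  refine ⟨K.h (n - 1) s.1.1, K.h n s.1.1, ?_⟩
  have hc := H.h_compl (n - 1) s.1.1
  rw [s.1.2, show 2 * n - (n - 1) = n - 2 + 3 by omega] at hc
  have hw : IsHighest 3 (fun i (u : Model (K.h (n - 1) s.1.1) (K.h n s.1.1)) => u.1.t i)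
      (wormVertex ⟨0, wormOK_zero⟩) := by
    intro i hi
    rcases mem_Icc_three hi with rfl | rfl | rfl <;> rfl
  have hh : ∀ i ∈ Set.Icc 1 3, (K.h (n - 2 + i) s.1.1 : ℤ) =
      (wormPt 0).h (K.h (n - 1) s.1.1) (K.h n s.1.1) i := by
    intro i hi
    rcases mem_Icc_three hi with rfl | rfl | rfl
    · simp [wormPt_zero, Pt.h, show n - 2 + 1 = n - 1 by omega]
    · simp [wormPt_zero, Pt.h, show n - 2 + 2 = n by omega]
    · simp [wormPt_zero, Pt.h, hc]
  obtain ⟨e, he⟩ := A.exists_equiv wormGraph_folded H.sub_localCrystal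
    (Model.localCrystal (K.h (n - 1) s.1.1) (K.h n s.1.1)) hs hw hh
  refine ⟨e, fun i a b => ?_⟩
  by_cases h1 : i = n - 1
  · subst h1
    simp only [if_true]
    exact (he a b).1
  by_cases h2 : i = n
  · subst h2
    simp only [h1, if_false, if_true]
    exact (he a b).2
  simp only [h1, h2, if_false]
  refine iff_of_false (fun h => ?_) (fun h => ?_)
  · rcases (sub_edge_iff.1 h).1 with h | h
    · exact h1 h
    · exact h2 h
  · have : (WormGraph (K.h (n - 1) s.1.1) (K.h n s.1.1)).F 0 (e a) = none := rfl
    rw [this] at h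
    cases h

end SymCrystal

/-- the symmetric extract from a symmetric `A_{2n-1}`-crystal `K(c)` is a
`B_n`-crystal with parameter `(c_1, …, c_n)`. -/
theorem symmetric_extract_is_B_crystal
    (n : ℕ) (hn : 2 ≤ n) (K : PreGraph) (hK : IsACrystal (2 * n - 1) K)
    (s : K.V) (hs : IsSource K s)
    (c : ℕ → ℕ) (hc : ∀ i, 1 ≤ i → i ≤ 2 * n - 1 → K.h i s = c i)
    (hsym : ∀ i, 1 ≤ i → i ≤ 2 * n - 1 → c i = c (2 * n - i))
    (σ : K.V → K.V) (hσb : Function.Bijective σ)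
    (hσ : ∀ (i : ℕ) (u v : K.V), K.F i u = some v ↔ K.F (2 * n - i) (σ u) = some (σ v)) :
    IsBCrystal n (extractB K n σ) ∧
    ∃ sB : (extractB K n σ).V, IsSource (extractB K n σ) sB ∧
      ∀ i, 1 ≤ i → i ≤ n → (extractB K n σ).h i sB = c i := by
  have H : SymCrystal n K σ := ⟨hn, hK, hσb, hσ⟩
  refine ⟨⟨H.extract_isColored, H.extract_connected hs,
    fun i hi j hj hij => H.extract_A5 hi hj hij,
    fun i j h1 h2 h3 h4 hij v => H.sub_isCrystalOn ⟨h1, h2⟩ ⟨h3, h4⟩ hij v,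
    H.sub_isoVia⟩, ⟨s, H.source_fixed hs⟩, ?_, ?_⟩
  · intro i u e
    have hi := SymCrystal.extract_color_mem e
    rcases hi.2.eq_or_lt with rfl | hlt
    · exact hs _ _ ((SymCrystal.extract_edge_self hi.1).1 e)
    · obtain ⟨m, -, h2⟩ := (SymCrystal.extract_edge_lt hi.1 hlt).1 e
      exact hs _ _ h2
  · intro i h1 h2
    exact (H.extract_h ⟨h1, h2⟩ _).trans (hc i h1 (by omega))
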